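/- arXiv:1604.08817 — 4 statements merged into one kernel-verified Lean document; each statement's English description precedes it below -/
import Mathlib

section
/- Fix an integer r ≥ 2 and let β be any one of the parameters tw, la, pw, ppw. Then NGΣ↑_β(r;n) = rn − o(n); that is, lim_{n→∞} NGΣ↑_β(r;n)/n = r. -/
open scoped Classical

namespace NG

/-- The set of earlier neighbors (back-neighborhood) of vertex `j` in `H`,
with respect to the natural order on `Fin N`. -/
noncomputable def backNbhd {N : ℕ} (H : SimpleGraph (Fin N)) (j : Fin N) :
    Finset (Fin N) :=
  Finset.univ.filter (fun i => (i : ℕ) < (j : ℕ) ∧ H.Adj i j)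

/-- The degree of `u` in the subgraph of `H` induced on the first `j` vertices
(the "stage `j`" graph of the construction). -/
noncomputable def stageDeg {N : ℕ} (H : SimpleGraph (Fin N)) (j : ℕ) (u : Fin N) : ℕ :=
  (Finset.univ.filter (fun w : Fin N => (w : ℕ) < j ∧ (u : ℕ) < j ∧ H.Adj u w)).card

/-- `H` on `Fin N` is a `k`-tree, built in the natural vertex order: the first
`k+1` vertices form a clique, and every later vertex is joined exactly to the
vertices of an existing `k`-clique. -/
def IsKTreeOrd (k : ℕ) (N : ℕ) (H : SimpleGraph (Fin N)) : Prop :=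
  1 ≤ k ∧ k + 1 ≤ N ∧
  (∀ i j : Fin N, (i : ℕ) < (j : ℕ) → (j : ℕ) ≤ k → H.Adj i j) ∧
  (∀ j : Fin N, k < (j : ℕ) →
    (backNbhd H j).card = k ∧ H.IsClique (backNbhd H j : Set (Fin N)))

/-- A linear `k`-tree: a `k`-tree in which each new vertex (after the first added
one) is joined to a `k`-clique containing the vertex added at the previous step. -/
def IsLinearKTreeOrd (k : ℕ) (N : ℕ) (H : SimpleGraph (Fin N)) : Prop :=
  IsKTreeOrd k N H ∧
  ∀ i j : Fin N, (i : ℕ) + 1 = (j : ℕ) → k + 1 < (j : ℕ) → i ∈ backNbhd H j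

/-- A `k`-caterpillar: a `k`-tree in which each new vertex (after the first added
one) is joined to a `k`-clique contained in the maximal `(k+1)`-clique created at
the previous stage. -/
def IsCaterpillarOrd (k : ℕ) (N : ℕ) (H : SimpleGraph (Fin N)) : Prop :=
  IsKTreeOrd k N H ∧
  ∀ i j : Fin N, (i : ℕ) + 1 = (j : ℕ) → k + 1 < (j : ℕ) →
    backNbhd H j ⊆ insert i (backNbhd H i)

/-- A two-sided `k`-tree: a `k`-tree in which each new vertex is joined to a
`k`-clique that either contains a vertex of degree `k` (at that stage) or equals
the `k`-clique to which some previously added vertex was joined. -/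
def IsTwoSidedKTreeOrd (k : ℕ) (N : ℕ) (H : SimpleGraph (Fin N)) : Prop :=
  IsKTreeOrd k N H ∧
  ∀ j : Fin N, k < (j : ℕ) →
    ((∃ u ∈ backNbhd H j, stageDeg H (j : ℕ) u = k) ∨
     (∃ i : Fin N, k < (i : ℕ) ∧ (i : ℕ) < (j : ℕ) ∧ backNbhd H i = backNbhd H j))

/-- The least `k` such that `G` embeds as a subgraph into some graph in the
class `P k`; an edgeless graph gets the value `0`. -/
noncomputable def widthParam (P : ℕ → (N : ℕ) → SimpleGraph (Fin N) → Prop)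
    (n : ℕ) (G : SimpleGraph (Fin n)) : ℕ :=
  if G = ⊥ then 0
  else sInf {k | ∃ (N : ℕ) (H : SimpleGraph (Fin N)) (f : Fin n ↪ Fin N),
    P k N H ∧ ∀ u v : Fin n, G.Adj u v → H.Adj (f u) (f v)}

/-- Tree-width: the least `k` such that `G` is a subgraph of a `k`-tree. -/
noncomputable def treewidth (n : ℕ) (G : SimpleGraph (Fin n)) : ℕ :=
  widthParam IsKTreeOrd n G

/-- Largeur d'arborescence: the least `k` such that `G` is a subgraph of a
two-sided `k`-tree. -/
noncomputable def la (n : ℕ) (G : SimpleGraph (Fin n)) : ℕ :=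
  widthParam IsTwoSidedKTreeOrd n G

/-- Path-width: the least `k` such that `G` is a subgraph of a `k`-caterpillar. -/
noncomputable def pw (n : ℕ) (G : SimpleGraph (Fin n)) : ℕ :=
  widthParam IsCaterpillarOrd n G

/-- Proper path-width: the least `k` such that `G` is a subgraph of a linear
`k`-tree. -/
noncomputable def ppw (n : ℕ) (G : SimpleGraph (Fin n)) : ℕ :=
  widthParam IsLinearKTreeOrd n G

/-- `G` has a complete-graph minor on `m` branch sets: there are `m` pairwise
disjoint nonempty connected vertex sets with an edge between every two of them. -/
def HasCliqueMinor {n : ℕ} (G : SimpleGraph (Fin n)) (m : ℕ) : Prop :=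
  ∃ B : Fin m → Finset (Fin n),
    (∀ p, (B p).Nonempty) ∧
    (∀ p, (G.induce ((B p : Finset (Fin n)) : Set (Fin n))).Connected) ∧
    (∀ p q, p ≠ q → Disjoint (B p) (B q)) ∧
    (∀ p q, p ≠ q → ∃ u ∈ B p, ∃ v ∈ B q, G.Adj u v)

/-- The Hadwiger number: the largest `m` such that `K_m` is a minor of `G`. -/
noncomputable def hadwiger (n : ℕ) (G : SimpleGraph (Fin n)) : ℕ :=
  sSup {m | HasCliqueMinor G m}

/-- `A` is a symmetric matrix whose off-diagonal nonzero pattern is the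
adjacency of `G`. -/
def DescribesGraph {n : ℕ} (A : Matrix (Fin n) (Fin n) ℝ)
    (G : SimpleGraph (Fin n)) : Prop :=
  A.IsSymm ∧ ∀ i j : Fin n, i ≠ j → (A i j ≠ 0 ↔ G.Adj i j)

/-- The Strong Arnold Property: the only symmetric `X` with `AX = O`,
`A∘X = O` and `I∘X = O` is `X = O`. -/
def StrongArnold {n : ℕ} (A : Matrix (Fin n) (Fin n) ℝ) : Prop :=
  ∀ X : Matrix (Fin n) (Fin n) ℝ, X.IsSymm → A * X = 0 →
    (∀ i j, A i j * X i j = 0) → (∀ i, X i i = 0) → X = 0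

/-- The nullity of a square real matrix. -/
noncomputable def nullity {n : ℕ} (A : Matrix (Fin n) (Fin n) ℝ) : ℕ :=
  Module.finrank ℝ (LinearMap.ker (Matrix.toLin' A))

/-- The Colin de Verdière type parameter `ξ`: maximum nullity of a matrix in
`S(G)` with the Strong Arnold Property. -/
noncomputable def xiParam (n : ℕ) (G : SimpleGraph (Fin n)) : ℕ :=
  sSup {m | ∃ A : Matrix (Fin n) (Fin n) ℝ,
    DescribesGraph A G ∧ StrongArnold A ∧ nullity A = m}

/-- The Colin de Verdière type parameter `ν`: maximum nullity of a positive
semidefinite matrix in `S(G)` with the Strong Arnold Property. -/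
noncomputable def nuParam (n : ℕ) (G : SimpleGraph (Fin n)) : ℕ :=
  sSup {m | ∃ A : Matrix (Fin n) (Fin n) ℝ,
    DescribesGraph A G ∧ A.PosSemidef ∧ StrongArnold A ∧ nullity A = m}

/-- The Colin de Verdière number `μ`: maximum nullity of a generalized
Laplacian in `S(G)` with exactly one negative eigenvalue and the Strong Arnold
Property. -/
noncomputable def muParam (n : ℕ) (G : SimpleGraph (Fin n)) : ℕ :=
  sSup {m | ∃ (A : Matrix (Fin n) (Fin n) ℝ) (hA : A.IsHermitian),
    DescribesGraph A G ∧ StrongArnold A ∧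
    (Finset.univ.filter (fun i => hA.eigenvalues i < 0)).card = 1 ∧
    (∀ i j : Fin n, i ≠ j → A i j ≤ 0) ∧ nullity A = m}

/-- An `r`-decomposition of `K_n`: spanning subgraphs with pairwise disjoint
edge sets whose union is all of `K_n`. -/
def IsDecomp {n r : ℕ} (G : Fin r → SimpleGraph (Fin n)) : Prop :=
  (∀ i j : Fin r, i ≠ j → Disjoint (G i) (G j)) ∧ (⨆ i, G i) = ⊤

/-- A non-degenerate `r`-decomposition: every part has at least one edge. -/
def IsNDDecomp {n r : ℕ} (G : Fin r → SimpleGraph (Fin n)) : Prop :=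
  IsDecomp G ∧ ∀ i, G i ≠ ⊥

/-- Nordhaus–Gaddum sum upper bound `NGΣ↑_β(r;n)`. -/
noncomputable def NGsumUp {n : ℕ} (β : SimpleGraph (Fin n) → ℕ) (r : ℕ) : ℕ :=
  sSup {s | ∃ G : Fin r → SimpleGraph (Fin n), IsDecomp G ∧ ∑ i, β (G i) = s}

/-- Nordhaus–Gaddum sum lower bound `NGΣ↓_β(r;n)`. -/
noncomputable def NGsumLow {n : ℕ} (β : SimpleGraph (Fin n) → ℕ) (r : ℕ) : ℕ :=
  sInf {s | ∃ G : Fin r → SimpleGraph (Fin n), IsDecomp G ∧ ∑ i, β (G i) = s}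

/-- Non-degenerate Nordhaus–Gaddum sum lower bound `NGΣ↓ⁿ_β(r;n)`. -/
noncomputable def NGsumLowND {n : ℕ} (β : SimpleGraph (Fin n) → ℕ) (r : ℕ) : ℕ :=
  sInf {s | ∃ G : Fin r → SimpleGraph (Fin n), IsNDDecomp G ∧ ∑ i, β (G i) = s}

/-- Nordhaus–Gaddum product upper bound `NGΠ↑_β(r;n)`. -/
noncomputable def NGprodUp {n : ℕ} (β : SimpleGraph (Fin n) → ℕ) (r : ℕ) : ℕ :=
  sSup {s | ∃ G : Fin r → SimpleGraph (Fin n), IsDecomp G ∧ ∏ i, β (G i) = s}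

/-- Non-degenerate Nordhaus–Gaddum product upper bound `NGΠ↑ⁿ_β(r;n)`. -/
noncomputable def NGprodUpND {n : ℕ} (β : SimpleGraph (Fin n) → ℕ) (r : ℕ) : ℕ :=
  sSup {s | ∃ G : Fin r → SimpleGraph (Fin n), IsNDDecomp G ∧ ∏ i, β (G i) = s}

/-- Nordhaus–Gaddum product lower bound `NGΠ↓_β(r;n)`. -/
noncomputable def NGprodLow {n : ℕ} (β : SimpleGraph (Fin n) → ℕ) (r : ℕ) : ℕ :=
  sInf {s | ∃ G : Fin r → SimpleGraph (Fin n), IsDecomp G ∧ ∏ i, β (G i) = s}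

/-- Non-degenerate Nordhaus–Gaddum product lower bound `NGΠ↓ⁿ_β(r;n)`. -/
noncomputable def NGprodLowND {n : ℕ} (β : SimpleGraph (Fin n) → ℕ) (r : ℕ) : ℕ :=
  sInf {s | ∃ G : Fin r → SimpleGraph (Fin n), IsNDDecomp G ∧ ∏ i, β (G i) = s}

/-- The triangular root `t(r) = ⌈√(2r + 1/4) − 1/2⌉`. -/
noncomputable def trt (r : ℕ) : ℕ := ⌈Real.sqrt (2 * (r : ℝ) + 1 / 4) - 1 / 2⌉₊

/-- `H` is a path together with isolated vertices: its edges are exactly those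
of a path through some list of distinct vertices. -/
def IsPathGraph {n : ℕ} (H : SimpleGraph (Fin n)) : Prop :=
  ∃ (m : ℕ) (f : Fin (m + 1) ↪ Fin n), ∀ u v : Fin n,
    H.Adj u v ↔ ∃ a b : Fin (m + 1), (a : ℕ) + 1 = (b : ℕ) ∧
      ((u = f a ∧ v = f b) ∨ (u = f b ∧ v = f a))

end NG

namespace NGaux

def Conn {n : ℕ} (G : SimpleGraph (Fin n)) (C : Finset (Fin n)) : Prop :=
  C.Nonempty ∧ ∀ S ⊆ C, S.Nonempty → (∀ a ∈ S, ∀ b ∈ C, b ∉ S → ¬ G.Adj a b) → S = C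

lemma Conn.mono {n : ℕ} {G H : SimpleGraph (Fin n)} (h : G ≤ H) {C : Finset (Fin n)}
    (hC : Conn G C) : Conn H C :=
  ⟨hC.1, fun S hS hne hcut => hC.2 S hS hne (fun a ha b hb hbS hab => hcut a ha b hb hbS (h hab))⟩

lemma chord {n : ℕ} (H : SimpleGraph (Fin n)) (p : Fin n → ℕ) (hp : Function.Injective p)
    (hcl : ∀ x u v, p u < p x → p v < p x → H.Adj u x → H.Adj v x → u ≠ v → H.Adj u v) :
    ∀ s : ℕ, ∀ C : Finset (Fin n), C.card = s → Conn H C → ∀ c ∈ C, (∀ x ∈ C, p c ≤ p x) →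
      ∀ u, p u < p c → ∀ v ∈ C, H.Adj u v → H.Adj u c := by
  intro s
  induction s with
  | zero =>
    intro C hC _ c hc
    rw [Finset.card_eq_zero] at hC
    simp [hC] at hc
  | succ s ih =>
    intro C hC hconn c hc hmin u hu v hv huv
    obtain ⟨z, hz, hzmax⟩ := Finset.exists_max_image C p hconn.1
    by_cases hzc : z = c
    · have : v = c := hp (le_antisymm (hzc ▸ hzmax v hv) (hmin v hv))
      rwa [← this]
    · have hcC' : c ∈ C.erase z := Finset.mem_erase.2 ⟨fun h => hzc h.symm, hc⟩
      have hlt : ∀ x ∈ C.erase z, p x < p z := by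
        intro x hx
        rw [Finset.mem_erase] at hx
        exact lt_of_le_of_ne (hzmax x hx.2) (fun h => hx.1 (hp h))
      have hconn' : Conn H (C.erase z) := by
        refine ⟨⟨c, hcC'⟩, ?_⟩
        intro S hS hne hcut
        have hzS : z ∉ S := fun h => by simpa using hS h
        have hSC : S ⊆ C := hS.trans (Finset.erase_subset _ _)
        by_cases hadj : ∃ y ∈ S, H.Adj y z
        · obtain ⟨y, hyS, hyz⟩ := hadj
          have key : insert z S = C := by
            apply hconn.2
            · exact Finset.insert_subset hz hSC
            · exact ⟨z, Finset.mem_insert_self _ _⟩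
            · intro a ha b hb hbS hab
              rw [Finset.mem_insert, not_or] at hbS
              have hb' : b ∈ C.erase z := Finset.mem_erase.2 ⟨hbS.1, hb⟩
              rcases Finset.mem_insert.1 ha with rfl | haS
              · refine hcut y hyS b hb' hbS.2 (hcl a y b (hlt y (hS hyS)) (hlt b hb') hyz hab.symm ?_)
                rintro rfl
                exact hbS.2 hyS
              · exact hcut a haS b hb' hbS.2 hab
          rw [← key, Finset.erase_insert hzS]
        · exfalso
          have : S = C := by
            apply hconn.2 S hSC hne
            intro a ha b hb hbS hab
            by_cases hbz : b = z
            · exact hadj ⟨a, ha, hbz ▸ hab⟩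
            · exact hcut a ha b (Finset.mem_erase.2 ⟨hbz, hb⟩) hbS hab
          exact hzS (this ▸ hz)
      have hcard : (C.erase z).card = s := by rw [Finset.card_erase_of_mem hz, hC]; rfl
      have hmin' : ∀ x ∈ C.erase z, p c ≤ p x := fun x hx => hmin x (Finset.mem_of_mem_erase hx)
      by_cases hvz : v = z
      · subst hvz
        have : ∃ y ∈ C.erase v, H.Adj v y := by
          by_contra hno
          push Not at hno
          have : {v} = C := by
            apply hconn.2 _ (by simpa using hz) (by simp)
            intro a ha b hb hbS
            simp at ha hbS
            subst ha
            exact hno b (Finset.mem_erase.2 ⟨hbS, hb⟩)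
          rw [← this] at hc
          simp at hc
          exact hzc hc.symm
        obtain ⟨y, hy, hvy⟩ := this
        have hpy := hlt y hy
        have huy : H.Adj u y := by
          apply hcl v u y (lt_of_lt_of_le hu (hmin v hv)) hpy huv hvy.symm
          rintro rfl
          exact absurd (hmin' u hy) (not_le.2 hu)
        exact ih _ hcard hconn' c hcC' hmin' u hu y hy huy
      · exact ih _ hcard hconn' c hcC' hmin' u hu v (Finset.mem_erase.2 ⟨hvz, hv⟩) huv

lemma exists_up {n : ℕ} (p : Fin n → ℕ) (t : ℕ) (ht : t ≤ n) :
    ∃ E : Finset (Fin n), E.card = t ∧ ∀ x ∈ E, ∀ y ∉ E, p y ≤ p x := by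
  induction t with
  | zero => exact ⟨∅, by simp⟩
  | succ t ih =>
    obtain ⟨E, hE, hup⟩ := ih (by omega)
    have hne : (Eᶜ).Nonempty := by
      rw [← Finset.card_pos, Finset.card_compl, Fintype.card_fin]; omega
    obtain ⟨z, hz, hzmax⟩ := Finset.exists_max_image Eᶜ p hne
    rw [Finset.mem_compl] at hz
    refine ⟨insert z E, by rw [Finset.card_insert_of_notMem hz, hE], ?_⟩
    intro x hx y hy
    rw [Finset.mem_insert, not_or] at hy
    rcases Finset.mem_insert.1 hx with rfl | hx
    · exact hzmax y (Finset.mem_compl.2 hy.2)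
    · exact hup x hx y hy.2

def Closed {n : ℕ} (G : SimpleGraph (Fin n)) (E S : Finset (Fin n)) : Prop :=
  S ⊆ E ∧ ∀ a ∈ S, ∀ b ∈ E, b ∉ S → ¬ G.Adj a b

def Expand {n : ℕ} (G : SimpleGraph (Fin n)) (m : ℕ) : Prop :=
  ∀ A B : Finset (Fin n), Disjoint A B → m ≤ A.card → m ≤ B.card → ∃ a ∈ A, ∃ b ∈ B, G.Adj a b

lemma exists_conn {n : ℕ} (G : SimpleGraph (Fin n)) (m : ℕ) (hm : 1 ≤ m) (hG : Expand G m)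
    (E : Finset (Fin n)) (hE : E.card = 3 * m) : ∃ C ⊆ E, m ≤ C.card ∧ Conn G C := by
  obtain ⟨S, hS, hSmin⟩ := Finset.exists_min_image
    (E.powerset.filter (fun S => Closed G E S ∧ m ≤ S.card)) Finset.card
    ⟨E, by
      simp only [Finset.mem_filter, Finset.mem_powerset]
      exact ⟨subset_rfl, ⟨subset_rfl, fun a _ b hb hb' => absurd hb hb'⟩, by omega⟩⟩
  simp only [Finset.mem_filter, Finset.mem_powerset] at hS hSmin
  obtain ⟨hSE, hScl, hSm⟩ := hS
  obtain ⟨C, hC, hCmin⟩ := Finset.exists_min_image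
    (S.powerset.filter (fun C => Closed G E C ∧ C.Nonempty)) Finset.card
    ⟨S, by
      simp only [Finset.mem_filter, Finset.mem_powerset]
      exact ⟨subset_rfl, hScl, Finset.card_pos.1 (by omega)⟩⟩
  simp only [Finset.mem_filter, Finset.mem_powerset] at hC hCmin
  obtain ⟨hCS, hCcl, hCne⟩ := hC
  refine ⟨C, hCcl.1, ?_, hCne, ?_⟩
  · by_contra hlt
    push Not at hlt
    have hcp := Finset.card_pos.2 hCne
    have hsd := Finset.card_sdiff_add_card_eq_card hCS
    have hsm : (S \ C).card < m := by
      by_contra hge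
      push Not at hge
      have := hSmin (S \ C) ⟨Finset.sdiff_subset.trans hSE,
        ⟨Finset.sdiff_subset.trans hSE, by
          intro a ha b hb hbS hab
          rw [Finset.mem_sdiff] at ha hbS
          by_cases hbC : b ∈ C
          · exact hCcl.2 b hbC a (hSE ha.1) ha.2 hab.symm
          · exact hScl.2 a ha.1 b hb (fun h => hbS ⟨h, hbC⟩) hab⟩, hge⟩
      omega
    have hEd := Finset.card_sdiff_add_card_eq_card hSE
    obtain ⟨a, ha, b, hb, hab⟩ := hG S (E \ S) Finset.disjoint_sdiff hSm (by omega)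
    rw [Finset.mem_sdiff] at hb
    exact hScl.2 a ha b hb.1 hb.2 hab
  · intro T hTC hTne hcut
    apply Finset.eq_of_subset_of_card_le hTC
    apply hCmin T
    refine ⟨hTC.trans hCS, ⟨hTC.trans hCcl.1, ?_⟩, hTne⟩
    intro a ha b hb hbT hab
    by_cases hbC : b ∈ C
    · exact hcut a ha b hbC hbT hab
    · exact hCcl.2 a (hTC ha) b hb hbC hab

lemma core {n : ℕ} (G H : SimpleGraph (Fin n)) (hGH : G ≤ H) (p : Fin n → ℕ)
    (hp : Function.Injective p) (k m : ℕ) (hm : 1 ≤ m) (hG : Expand G m)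
    (hcl : ∀ x u v, p u < p x → p v < p x → H.Adj u x → H.Adj v x → u ≠ v → H.Adj u v)
    (hback : ∀ x, (Finset.univ.filter (fun u => p u < p x ∧ H.Adj u x)).card ≤ k) :
    n ≤ k + 4 * m := by
  by_cases hn : n ≤ 4 * m
  · omega
  obtain ⟨E, hE, hup⟩ := exists_up p (3 * m) (by omega)
  obtain ⟨C, hCE, hCm, hC⟩ := exists_conn G m hm hG E hE
  obtain ⟨c, hc, hcmin⟩ := Finset.exists_min_image C p hC.1
  have hback := hback c
  set B := Finset.univ.filter (fun u => p u < p c ∧ H.Adj u c) with hB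
  by_contra hlt
  push Not at hlt
  have h1 : m ≤ (Eᶜ \ B).card := by
    have := Finset.le_card_sdiff B Eᶜ
    rw [Finset.card_compl, Fintype.card_fin] at this
    omega
  have hdis : Disjoint C (Eᶜ \ B) := by
    rw [Finset.disjoint_left]
    intro a ha hb
    rw [Finset.mem_sdiff, Finset.mem_compl] at hb
    exact hb.1 (hCE ha)
  obtain ⟨v, hv, u, hu, huv⟩ := hG C _ hdis hCm h1
  rw [Finset.mem_sdiff, Finset.mem_compl] at hu
  have hne : u ≠ c := fun h => hu.1 (h ▸ hCE hc)
  have hlt : p u < p c := lt_of_le_of_ne (hup c (hCE hc) u hu.1) (fun h => hne (hp h))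
  apply hu.2
  rw [hB, Finset.mem_filter]
  exact ⟨Finset.mem_univ _, hlt,
    chord H p hp hcl _ C rfl (hC.mono hGH) c hc hcmin u hlt v hv (hGH huv.symm)⟩

lemma ktree_bound {n : ℕ} (G : SimpleGraph (Fin n)) (m : ℕ) (hm : 1 ≤ m) (hG : Expand G m)
    (k N : ℕ) (H : SimpleGraph (Fin N)) (f : Fin n ↪ Fin N) (hH : NG.IsKTreeOrd k N H)
    (hf : ∀ u v : Fin n, G.Adj u v → H.Adj (f u) (f v)) : n ≤ k + 4 * m := by
  obtain ⟨hk, hkN, hbase, hstep⟩ := hH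
  refine core G (H.comap f) (fun u v h => hf u v h) (fun u => (f u : ℕ))
    (fun a b h => f.injective (Fin.ext h)) k m hm hG ?_ ?_
  · intro x u v hu hv hux hvx huv
    simp only [SimpleGraph.comap_adj] at *
    have hne : f u ≠ f v := fun h => huv (f.injective h)
    by_cases hx : (f x : ℕ) ≤ k
    · rcases lt_trichotomy (f u : ℕ) (f v : ℕ) with h | h | h
      · exact hbase _ _ h (by omega)
      · exact absurd (Fin.ext h) hne
      · exact (hbase _ _ h (by omega)).symm
    · refine (hstep (f x) (by omega)).2 ?_ ?_ hne
      · simp [NG.backNbhd]; exact ⟨hu, hux⟩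
      · simp [NG.backNbhd]; exact ⟨hv, hvx⟩
  · intro x
    by_cases hx : (f x : ℕ) ≤ k
    · calc _ ≤ (Finset.range (f x : ℕ)).card := by
            apply Finset.card_le_card_of_injOn (fun u => (f u : ℕ))
            · intro u hu
              simp at hu ⊢
              exact hu.1
            · intro a _ b _ h
              exact f.injective (Fin.ext h)
        _ ≤ k := by simpa using hx
    · rw [← (hstep (f x) (by omega)).1]
      apply Finset.card_le_card_of_injOn f
      · intro u hu
        simp [NG.backNbhd] at hu ⊢
        exact hu
      · exact f.injective.injOn

lemma width_lower (P : ℕ → (N : ℕ) → SimpleGraph (Fin N) → Prop)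
    (hP : ∀ k N H, P k N H → NG.IsKTreeOrd k N H)
    (hP' : ∀ N, 1 ≤ N → P N (N + 1) ⊤) {n : ℕ} (G : SimpleGraph (Fin n)) (m : ℕ) (hm : 1 ≤ m)
    (hG : Expand G m) : n ≤ NG.widthParam P n G + 4 * m := by
  by_cases hn : n ≤ 4 * m
  · omega
  have hbot : G ≠ ⊥ := by
    rintro rfl
    obtain ⟨A, hA⟩ := Finset.exists_subset_card_eq (s := (Finset.univ : Finset (Fin n))) (n := m)
      (by simp; omega)
    obtain ⟨a, _, b, _, hab⟩ := hG A Aᶜ disjoint_compl_right (by omega)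
      (by rw [Finset.card_compl, Fintype.card_fin]; omega)
    simpa using hab
  rw [NG.widthParam, if_neg hbot]
  have hmem := Nat.sInf_mem (s := {k | ∃ (N : ℕ) (H : SimpleGraph (Fin N)) (f : Fin n ↪ Fin N),
    P k N H ∧ ∀ u v : Fin n, G.Adj u v → H.Adj (f u) (f v)}) (by
      obtain ⟨N, rfl⟩ : ∃ N, n = N + 1 := ⟨n - 1, by omega⟩
      exact ⟨N, N + 1, ⊤, Function.Embedding.refl _, hP' N (by omega), fun u v h => h.ne⟩)
  obtain ⟨N, H, f, hPH, hf⟩ := hmem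
  exact ktree_bound G m hm hG _ N H f (hP _ _ _ hPH) hf

lemma width_upper (P : ℕ → (N : ℕ) → SimpleGraph (Fin N) → Prop)
    (hP' : ∀ N, 1 ≤ N → P N (N + 1) ⊤) {n : ℕ} (G : SimpleGraph (Fin n)) :
    NG.widthParam P n G ≤ n := by
  rw [NG.widthParam]
  split_ifs with h
  · omega
  · have hn : 2 ≤ n := by
      by_contra hn
      apply h
      ext u v
      have : u = v := Fin.ext (by omega)
      simp [this]
    obtain ⟨N, rfl⟩ : ∃ N, n = N + 1 := ⟨n - 1, by omega⟩
    refine (Nat.sInf_le (m := N) ?_).trans (by omega)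
    exact ⟨N + 1, ⊤, Function.Embedding.refl _, hP' N (by omega), fun u v h => h.ne⟩

lemma ktree_top (N : ℕ) (hN : 1 ≤ N) : NG.IsKTreeOrd N (N + 1) ⊤ := by
  refine ⟨hN, le_rfl, ?_, ?_⟩
  · intro i j h _
    simp only [SimpleGraph.top_adj]
    rintro rfl
    omega
  · intro j hj
    omega

lemma beta_props (β : (n : ℕ) → SimpleGraph (Fin n) → ℕ)
    (hβ : β = NG.treewidth ∨ β = NG.la ∨ β = NG.pw ∨ β = NG.ppw) :
    (∀ n (G : SimpleGraph (Fin n)), β n G ≤ n) ∧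
    (∀ n (G : SimpleGraph (Fin n)) m, 1 ≤ m → Expand G m → n ≤ β n G + 4 * m) := by
  rcases hβ with rfl | rfl | rfl | rfl
  · exact ⟨fun n G => width_upper _ ktree_top G,
      fun n G m hm hG => width_lower _ (fun _ _ _ h => h) ktree_top G m hm hG⟩
  · have h : ∀ N, 1 ≤ N → NG.IsTwoSidedKTreeOrd N (N + 1) ⊤ :=
      fun N hN => ⟨ktree_top N hN, fun j hj => by omega⟩
    exact ⟨fun n G => width_upper _ h G,
      fun n G m hm hG => width_lower _ (fun _ _ _ h => h.1) h G m hm hG⟩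
  · have h : ∀ N, 1 ≤ N → NG.IsCaterpillarOrd N (N + 1) ⊤ :=
      fun N hN => ⟨ktree_top N hN, fun i j _ hj => by omega⟩
    exact ⟨fun n G => width_upper _ h G,
      fun n G m hm hG => width_lower _ (fun _ _ _ h => h.1) h G m hm hG⟩
  · have h : ∀ N, 1 ≤ N → NG.IsLinearKTreeOrd N (N + 1) ⊤ :=
      fun N hN => ⟨ktree_top N hN, fun i j _ hj => by omega⟩
    exact ⟨fun n G => width_upper _ h G,
      fun n G m hm hG => width_lower _ (fun _ _ _ h => h.1) h G m hm hG⟩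

def colG {n r : ℕ} (c : Sym2 (Fin n) → Fin r) (i : Fin r) : SimpleGraph (Fin n) where
  Adj u v := u ≠ v ∧ c s(u, v) = i
  symm := ⟨fun u v h => ⟨h.1.symm, by rw [Sym2.eq_swap]; exact h.2⟩⟩
  loopless := ⟨fun u h => h.1 rfl⟩

lemma colG_decomp {n r : ℕ} (c : Sym2 (Fin n) → Fin r) : NG.IsDecomp (colG c) := by
  constructor
  · intro i j hij
    rw [SimpleGraph.disjoint_left]
    rintro u v ⟨_, h1⟩ ⟨_, h2⟩
    exact hij (h1.symm.trans h2)
  · ext u v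
    simp [SimpleGraph.iSup_adj, colG]

lemma card_bad {n r m : ℕ} (hr : 1 ≤ r) (i : Fin r) (A B : Finset (Fin n)) (hd : Disjoint A B)
    (hA : A.card = m) (hB : B.card = m) :
    (Finset.univ.filter (fun c : Sym2 (Fin n) → Fin r =>
      ∀ a ∈ A, ∀ b ∈ B, c s(a, b) ≠ i)).card * r ^ (m * m) ≤
      (r - 1) ^ (m * m) * r ^ Fintype.card (Sym2 (Fin n)) := by
  set F : Finset (Sym2 (Fin n)) := (A ×ˢ B).image (fun q => s(q.1, q.2)) with hF
  have hFc : F.card = m * m := by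
    rw [hF, Finset.card_image_of_injOn, Finset.card_product, hA, hB]
    rintro ⟨a, b⟩ h ⟨a', b'⟩ h' heq
    simp only [Finset.coe_product, Set.mem_prod, Finset.mem_coe] at h h'
    simp only [Sym2.eq_iff] at heq
    rcases heq with ⟨rfl, rfl⟩ | ⟨rfl, rfl⟩
    · rfl
    · exact absurd h'.2 (Finset.disjoint_left.1 hd h.1)
  have hsub : (Finset.univ.filter (fun c : Sym2 (Fin n) → Fin r =>
      ∀ a ∈ A, ∀ b ∈ B, c s(a, b) ≠ i)) ⊆
      Fintype.piFinset (fun e => if e ∈ F then Finset.univ.erase i else Finset.univ) := by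
    intro c hc
    simp only [Finset.mem_filter, Finset.mem_univ, true_and] at hc
    rw [Fintype.mem_piFinset]
    intro e
    split_ifs with he
    · rw [hF, Finset.mem_image] at he
      obtain ⟨⟨a, b⟩, hab, rfl⟩ := he
      rw [Finset.mem_product] at hab
      simpa using hc a hab.1 b hab.2
    · simp
  have hcard : (Fintype.piFinset (fun e => if e ∈ F then (Finset.univ : Finset (Fin r)).erase i
      else Finset.univ)).card * r ^ (m * m) = (r - 1) ^ (m * m) * r ^ Fintype.card (Sym2 (Fin n)) := by
    rw [Fintype.card_piFinset]
    have : ∀ e, (if e ∈ F then (Finset.univ : Finset (Fin r)).erase i else Finset.univ).card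
        = if e ∈ F then r - 1 else r := by
      intro e
      split_ifs <;> simp
    simp only [this]
    rw [Finset.prod_ite, Finset.prod_const, Finset.prod_const]
    have h1 : (Finset.univ.filter (fun e => e ∈ F)) = F := by ext; simp
    have h2 : (Finset.univ.filter (fun e => e ∉ F)) = Fᶜ := by ext; simp
    rw [h1, h2, hFc, mul_assoc, ← pow_add]
    have := Finset.card_compl_add_card F
    rw [hFc] at this
    rw [this]
  rw [← hcard]
  exact Nat.mul_le_mul_right _ (Finset.card_le_card hsub)

lemma exists_col {n r m : ℕ} (hr : 1 ≤ r)
    (hlt : r * (2 ^ n * 2 ^ n) * (r - 1) ^ (m * m) < r ^ (m * m)) :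
    ∃ c : Sym2 (Fin n) → Fin r, ∀ i, Expand (colG c i) m := by
  by_contra hno
  push Not at hno
  set I : Finset (Fin r × Finset (Fin n) × Finset (Fin n)) :=
    Finset.univ.filter (fun t => Disjoint t.2.1 t.2.2 ∧ t.2.1.card = m ∧ t.2.2.card = m) with hI
  set T := Fintype.card (Sym2 (Fin n)) with hT
  have hcov : (Finset.univ : Finset (Sym2 (Fin n) → Fin r)) ⊆ I.biUnion (fun t =>
      Finset.univ.filter (fun c : Sym2 (Fin n) → Fin r =>
      ∀ a ∈ t.2.1, ∀ b ∈ t.2.2, c s(a, b) ≠ t.1)) := by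
    intro c _
    obtain ⟨i, hi⟩ := hno c
    unfold Expand at hi
    push Not at hi
    obtain ⟨A, B, hd, hA, hB, hAB⟩ := hi
    obtain ⟨A', hA', hA'c⟩ := Finset.exists_subset_card_eq hA
    obtain ⟨B', hB', hB'c⟩ := Finset.exists_subset_card_eq hB
    rw [Finset.mem_biUnion]
    refine ⟨(i, A', B'), ?_, ?_⟩
    · simp only [hI, Finset.mem_filter, Finset.mem_univ, true_and]
      exact ⟨Finset.disjoint_of_subset_left hA' (Finset.disjoint_of_subset_right hB' hd), hA'c, hB'c⟩
    · simp only [Finset.mem_filter, Finset.mem_univ, true_and]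
      intro a ha b hb heq
      refine hAB a (hA' ha) b (hB' hb) ⟨?_, heq⟩
      rintro rfl
      exact Finset.disjoint_left.1 hd (hA' ha) (hB' hb)
  have h1 := (Finset.card_le_card hcov).trans Finset.card_biUnion_le
  rw [Finset.card_univ, Fintype.card_fun, Fintype.card_fin, ← hT] at h1
  have h2 := Nat.mul_le_mul_right (r ^ (m * m)) h1
  rw [Finset.sum_mul] at h2
  have h3 : ∀ t ∈ I, (Finset.univ.filter (fun c : Sym2 (Fin n) → Fin r =>
      ∀ a ∈ t.2.1, ∀ b ∈ t.2.2, c s(a, b) ≠ t.1)).card * r ^ (m * m) ≤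
      (r - 1) ^ (m * m) * r ^ T := by
    intro t ht
    simp only [hI, Finset.mem_filter, Finset.mem_univ, true_and] at ht
    exact card_bad hr t.1 t.2.1 t.2.2 ht.1 ht.2.1 ht.2.2
  have h4 := h2.trans (Finset.sum_le_sum h3)
  rw [Finset.sum_const, smul_eq_mul] at h4
  have h5 : I.card ≤ r * (2 ^ n * 2 ^ n) := by
    refine (Finset.card_le_univ I).trans ?_
    simp [Fintype.card_prod]
  have h6 : r ^ T * r ^ (m * m) ≤ r * (2 ^ n * 2 ^ n) * ((r - 1) ^ (m * m) * r ^ T) :=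
    h4.trans (Nat.mul_le_mul_right _ h5)
  have h7 : 0 < r ^ T := by positivity
  nlinarith

lemma exists_L (r : ℕ) (hr : 1 ≤ r) : ∃ L : ℕ, 1 ≤ L ∧ (4 * r) * (r - 1) ^ L < r ^ L := by
  have hr0 : (0 : ℝ) < r := by exact_mod_cast hr
  have h0 : (0 : ℝ) ≤ ((r - 1 : ℕ) : ℝ) / r := by positivity
  have h1 : ((r - 1 : ℕ) : ℝ) / r < 1 := by
    rw [div_lt_one hr0]
    exact_mod_cast (by omega : r - 1 < r)
  have ht := tendsto_pow_atTop_nhds_zero_of_lt_one h0 h1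
  have hev := (ht.eventually (gt_mem_nhds (show (0 : ℝ) < 1 / (4 * r) by positivity))).and
    (Filter.eventually_ge_atTop 1)
  obtain ⟨L, hL, hL1⟩ := hev.exists
  refine ⟨L, hL1, ?_⟩
  rw [div_pow, div_lt_div_iff₀ (by positivity) (by positivity)] at hL
  have : ((4 * r * (r - 1) ^ L : ℕ) : ℝ) < ((r ^ L : ℕ) : ℝ) := by
    push_cast
    linarith
  exact_mod_cast this

lemma arith (r L n m : ℕ) (hr : 1 ≤ r) (hn : 1 ≤ n) (hL : (4 * r) * (r - 1) ^ L < r ^ L)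
    (hm : L * n ≤ m * m) : r * (2 ^ n * 2 ^ n) * (r - 1) ^ (m * m) < r ^ (m * m) := by
  obtain ⟨d, hd⟩ := Nat.exists_eq_add_of_le hm
  have h1 : ((4 * r) * (r - 1) ^ L) ^ n < (r ^ L) ^ n := Nat.pow_lt_pow_left hL (by omega)
  have h2 : r * (2 ^ n * 2 ^ n) ≤ (4 * r) ^ n := by
    rw [← mul_pow, mul_pow 4 r n, mul_comm]
    exact Nat.mul_le_mul_left _ (Nat.le_self_pow (by omega) r)
  have h3 : (r - 1) ^ d ≤ r ^ d := Nat.pow_le_pow_left (by omega) d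
  rw [hd, pow_add, pow_add, pow_mul, pow_mul]
  rw [mul_pow] at h1
  have h4 : 0 < r ^ d := by positivity
  calc r * (2 ^ n * 2 ^ n) * (((r - 1) ^ L) ^ n * (r - 1) ^ d)
      ≤ (4 * r) ^ n * (((r - 1) ^ L) ^ n * r ^ d) := by gcongr
    _ = (4 * r) ^ n * ((r - 1) ^ L) ^ n * r ^ d := by ring
    _ < (r ^ L) ^ n * r ^ d := Nat.mul_lt_mul_of_pos_right h1 h4

end NGaux

/-- For fixed `r ≥ 2` and `β` one of tree-width, largeur d'arborescence,
path-width, proper path-width: `lim_{n→∞} NGΣ↑_β(r;n)/n = r`. -/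
theorem statement0 (r : ℕ) (hr : 2 ≤ r)
    (β : (n : ℕ) → SimpleGraph (Fin n) → ℕ)
    (hβ : β = NG.treewidth ∨ β = NG.la ∨ β = NG.pw ∨ β = NG.ppw) :
    Filter.Tendsto (fun n : ℕ => (NG.NGsumUp (β n) r : ℝ) / (n : ℝ))
      Filter.atTop (nhds (r : ℝ)) := by
  obtain ⟨hup, hlow⟩ := NGaux.beta_props β hβ
  obtain ⟨L, hL1, hL⟩ := NGaux.exists_L r (by omega)
  have hbd : ∀ n, ∀ s ∈ {s | ∃ G : Fin r → SimpleGraph (Fin n), NG.IsDecomp G ∧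
      ∑ i, β n (G i) = s}, s ≤ r * n := by
    rintro n s ⟨G, _, rfl⟩
    calc ∑ i, β n (G i) ≤ ∑ _i : Fin r, n := Finset.sum_le_sum (fun i _ => hup n (G i))
      _ = r * n := by simp
  have hle : ∀ n, NG.NGsumUp (β n) r ≤ r * n := by
    intro n
    unfold NG.NGsumUp
    exact csSup_le' (hbd n)
  have hge : ∀ n, 1 ≤ n → r * n ≤ NG.NGsumUp (β n) r + r * (4 * (L * (Nat.sqrt n + 1))) := by
    intro n hn
    have hs : n < (Nat.sqrt n + 1) * (Nat.sqrt n + 1) := Nat.lt_succ_sqrt n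
    obtain ⟨c, hc⟩ := NGaux.exists_col (n := n) (r := r) (m := L * (Nat.sqrt n + 1)) (by omega)
      (NGaux.arith r L n _ (by omega) hn hL (by
        calc L * n ≤ (L * L) * ((Nat.sqrt n + 1) * (Nat.sqrt n + 1)) :=
              Nat.mul_le_mul (Nat.le_mul_self L) hs.le
          _ = _ := by ring))
    have h1 : ∑ i, β n (NGaux.colG c i) ≤ NG.NGsumUp (β n) r := by
      unfold NG.NGsumUp
      exact le_csSup ⟨r * n, hbd n⟩ ⟨NGaux.colG c, NGaux.colG_decomp c, rfl⟩
    have h2 : ∑ _i : Fin r, n ≤ ∑ i, (β n (NGaux.colG c i) + 4 * (L * (Nat.sqrt n + 1))) :=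
      Finset.sum_le_sum (fun i _ => hlow n _ _ (Nat.mul_pos hL1 (Nat.succ_pos _)) (hc i))
    rw [Finset.sum_add_distrib] at h2
    simp only [Finset.sum_const, Finset.card_univ, Fintype.card_fin, smul_eq_mul] at h2
    omega
  have hsq : Filter.Tendsto (fun n : ℕ => (r : ℝ) - 4 * r * L * ((Real.sqrt n)⁻¹ + (n : ℝ)⁻¹))
      Filter.atTop (nhds (r : ℝ)) := by
    have ha : Filter.Tendsto (fun n : ℕ => (Real.sqrt n)⁻¹) Filter.atTop (nhds 0) :=
      tendsto_inv_atTop_zero.comp (Real.tendsto_sqrt_atTop.comp tendsto_natCast_atTop_atTop)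
    have hb : Filter.Tendsto (fun n : ℕ => (n : ℝ)⁻¹) Filter.atTop (nhds 0) :=
      tendsto_inv_atTop_zero.comp tendsto_natCast_atTop_atTop
    have := ((ha.add hb).const_mul (4 * (r : ℝ) * L)).const_sub (r : ℝ)
    simpa using this
  refine tendsto_of_tendsto_of_tendsto_of_le_of_le' hsq tendsto_const_nhds ?_ ?_
  · filter_upwards [Filter.eventually_ge_atTop 1] with n hn
    have hn0 : (0 : ℝ) < n := by exact_mod_cast hn
    have h1 : (r : ℝ) * n ≤ NG.NGsumUp (β n) r + r * (4 * (L * (Nat.sqrt n + 1))) := by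
      exact_mod_cast hge n hn
    have h2 : ((Nat.sqrt n : ℕ) : ℝ) ≤ Real.sqrt n := Real.nat_sqrt_le_real_sqrt
    have h3 : (Real.sqrt n)⁻¹ * n = Real.sqrt n := by
      have hs : (0 : ℝ) < Real.sqrt n := Real.sqrt_pos.2 hn0
      have := Real.mul_self_sqrt hn0.le
      field_simp
      nlinarith
    rw [le_div_iff₀ hn0]
    have h4 : (n : ℝ)⁻¹ * n = 1 := inv_mul_cancel₀ hn0.ne'
    have h5 : ((r : ℝ) - 4 * r * L * ((Real.sqrt n)⁻¹ + (n : ℝ)⁻¹)) * n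
        = r * n - 4 * r * L * (Real.sqrt n + 1) := by
      rw [sub_mul, mul_assoc (4 * (r : ℝ) * L), add_mul, h3, h4]
    rw [h5]
    have h6 : 4 * (r : ℝ) * L * (Nat.sqrt n + 1) ≤ 4 * r * L * (Real.sqrt n + 1) := by gcongr
    linarith
  · filter_upwards [Filter.eventually_ge_atTop 1] with n hn
    have hn0 : (0 : ℝ) < n := by exact_mod_cast hn
    rw [div_le_iff₀ hn0]
    exact_mod_cast hle n
end

section
/- Let r ≥ 2 and let n be an integer with n² ≥ 4r (i.e., n ≥ 2√r). Then for each β ∈ {ξ, ν, μ}, NGΣ↑_β(r;n) ≤ √r · n. Moreover NGΣ↑_η(r;n) ≤ √r · n + r. -/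
open scoped Classical

namespace NG

lemma support_lemma {n : ℕ} {G : SimpleGraph (Fin n)} {A : Matrix (Fin n) (Fin n) ℝ}
    (hA : DescribesGraph A G) (hS : StrongArnold A) (u : Fin n) (x₀ x : Fin n → ℝ)
    (h0 : A.mulVec x₀ = 0) (hu : x₀ u ≠ 0) (hx : A.mulVec x = 0) (j : Fin n)
    (hj : ¬ G.Reachable u j) : x j = 0 := by
  set c : Fin n → ℝ := fun i => if G.Reachable u i then 1 else 0 with hc
  have hcc : ∀ i j, A i j * c i = A i j * c j := by
    intro i j
    by_cases hij : i = j
    · rw [hij]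
    by_cases ha : A i j = 0
    · simp [ha]
    have hadj := (hA.2 i j hij).1 ha
    have : G.Reachable u i ↔ G.Reachable u j :=
      ⟨fun h => h.trans hadj.reachable, fun h => h.trans hadj.symm.reachable⟩
    simp [hc, this]
  have hci : ∀ i, c i * (1 - c i) = 0 := by
    intro i; simp only [hc]; split_ifs <;> simp
  have e0 : ∀ i, ∑ k, A i k * x₀ k = 0 := fun i => congrFun h0 i
  have e1 : ∀ i, ∑ k, A i k * x k = 0 := fun i => congrFun hx i
  have ez : ∀ i, ∑ k, A i k * (c k * x₀ k) = 0 := by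
    intro i
    have : ∑ k, A i k * (c k * x₀ k) = c i * ∑ k, A i k * x₀ k := by
      rw [Finset.mul_sum]
      refine Finset.sum_congr rfl fun k _ => ?_
      linear_combination (-x₀ k) * hcc i k
    rw [this, e0, mul_zero]
  have ew : ∀ i, ∑ k, A i k * ((1 - c k) * x k) = 0 := by
    intro i
    have : ∑ k, A i k * ((1 - c k) * x k) = (1 - c i) * ∑ k, A i k * x k := by
      rw [Finset.mul_sum]
      refine Finset.sum_congr rfl fun k _ => ?_
      linear_combination (x k) * hcc i k
    rw [this, e1, mul_zero]
  have key := hS (Matrix.of fun i k => (c i * x₀ i) * ((1 - c k) * x k) +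
      ((1 - c i) * x i) * (c k * x₀ k)) ?_ ?_ ?_ ?_
  · have := congrFun (congrFun key u) j
    have cu : c u = 1 := by simp [hc]
    have cj : c j = 0 := by simp [hc, hj]
    simp [cu, cj, hu] at this
    exact this
  · ext i k
    simp only [Matrix.transpose_apply, Matrix.of_apply]; ring
  · ext i k
    simp only [Matrix.mul_apply, Matrix.of_apply, Matrix.zero_apply]
    have : ∑ l, A i l * ((c l * x₀ l) * ((1 - c k) * x k) + ((1 - c l) * x l) * (c k * x₀ k))
      = (∑ l, A i l * (c l * x₀ l)) * ((1 - c k) * x k)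
        + (∑ l, A i l * ((1 - c l) * x l)) * (c k * x₀ k) := by
      rw [Finset.sum_mul, Finset.sum_mul, ← Finset.sum_add_distrib]
      exact Finset.sum_congr rfl fun l _ => by ring
    rw [this, ez, ew]; ring
  · intro i k
    simp only [Matrix.of_apply]
    linear_combination (x₀ i * (1 - c k) * x k - x i * x₀ k * c k) * hcc i k
      + (A i k * x₀ i * x k + A i k * x i * x₀ k) * hci k
  · intro i
    simp only [Matrix.of_apply]
    linear_combination (2 * x₀ i * x i) * hci i

lemma sap_bound {n : ℕ} {G : SimpleGraph (Fin n)} {A : Matrix (Fin n) (Fin n) ℝ}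
    (hA : DescribesGraph A G) (hS : StrongArnold A) :
    nullity A * (nullity A + 1) ≤ 2 * (Nat.card G.edgeSet + 1) := by
  obtain ⟨k, hk⟩ : ∃ k, nullity A = k := ⟨_, rfl⟩
  rw [hk]
  rcases Nat.eq_zero_or_pos k with rfl | hkpos
  · simp
  let b := Module.finBasisOfFinrankEq ℝ (LinearMap.ker (Matrix.toLin' A)) hk
  let v : Fin k → Fin n → ℝ := fun p => (b p : Fin n → ℝ)
  have hv : ∀ p, A.mulVec (v p) = 0 := by
    intro p
    have := (b p).2
    rw [LinearMap.mem_ker, Matrix.toLin'_apply] at this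
    exact this
  have hli : LinearIndependent ℝ v :=
    b.linearIndependent.map' (Submodule.subtype _) (Submodule.ker_subtype _)
  have hli' : ∀ g : Fin k → ℝ, (∀ i, ∑ p, g p * v p i = 0) → ∀ p, g p = 0 := by
    intro g hg
    refine Fintype.linearIndependent_iff.1 hli g ?_
    ext i
    simpa using hg i
  obtain ⟨u, hu⟩ : ∃ u, v ⟨0, hkpos⟩ u ≠ 0 := by
    have := hli.ne_zero ⟨0, hkpos⟩
    exact Function.ne_iff.1 this
  have hsupp : ∀ p j, ¬ G.Reachable u j → v p j = 0 := fun p j hj =>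
    support_lemma hA hS u _ _ (hv ⟨0, hkpos⟩) hu (hv p) j hj
  let X : (Sym2 (Fin k) → ℝ) →ₗ[ℝ] Fin n → Fin n → ℝ :=
    { toFun := fun c i j => ∑ p, ∑ q, c s(p, q) * (v p i * v q j)
      map_add' := by
        intro c d; ext i j
        simp [add_mul, Finset.sum_add_distrib]
      map_smul' := by
        intro t c; ext i j
        simp [Finset.mul_sum, mul_assoc] }
  have hXdef : ∀ c i j, X c i j = ∑ p, ∑ q, c s(p, q) * (v p i * v q j) := fun _ _ _ => rfl
  have hXsymm : ∀ c i j, X c i j = X c j i := by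
    intro c i j
    rw [hXdef, hXdef, Finset.sum_comm]
    refine Finset.sum_congr rfl fun p _ => Finset.sum_congr rfl fun q _ => ?_
    rw [Sym2.eq_swap]; ring
  have hAX : ∀ c i j, ∑ l, A i l * X c l j = 0 := by
    intro c i j
    simp only [hXdef, Finset.mul_sum]
    rw [Finset.sum_comm]
    refine Finset.sum_eq_zero fun p _ => ?_
    rw [Finset.sum_comm]
    refine Finset.sum_eq_zero fun q _ => ?_
    have h1 : ∑ l, A i l * v p l = 0 := congrFun (hv p) i
    calc _ = (∑ l, A i l * v p l) * (c s(p, q) * v q j) := by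
          rw [Finset.sum_mul]
          exact Finset.sum_congr rfl fun l _ => by ring
      _ = 0 := by rw [h1, zero_mul]
  have hXinj : ∀ c, (∀ i j, X c i j = 0) → c = 0 := by
    intro c hc
    have h1 : ∀ j p, ∑ q, c s(p, q) * v q j = 0 := by
      intro j
      refine hli' (fun p => ∑ q, c s(p, q) * v q j) ?_
      intro i
      rw [← hc i j, hXdef]
      refine Finset.sum_congr rfl fun p _ => ?_
      rw [Finset.sum_mul]
      exact Finset.sum_congr rfl fun q _ => by ring
    ext s
    induction s using Sym2.ind with
    | _ p q => exact hli' (fun q => c s(p, q)) (fun i => h1 i p) q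
  have hXsupp : ∀ c i, ¬ G.Reachable u i → X c i i = 0 := by
    intro c i hi
    rw [hXdef]
    refine Finset.sum_eq_zero fun p _ => Finset.sum_eq_zero fun q _ => ?_
    rw [hsupp p i hi]; simp
  let γ : Fin n → ℝ := fun i => if G.Reachable u i then 1 else 0
  let yy : ({i : Fin n // i ≠ u} → ℝ) →ₗ[ℝ] Fin n → ℝ :=
    { toFun := fun y i => if h : i ≠ u then y ⟨i, h⟩ else 0
      map_add' := by
        intro y z; ext i; by_cases h : i = u <;> simp [h]
      map_smul' := by
        intro t y; ext i; by_cases h : i = u <;> simp [h] }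
  let M : ((Sym2 (Fin k) → ℝ) × ({i : Fin n // i ≠ u} → ℝ)) →ₗ[ℝ] Fin n → Fin n → ℝ :=
    { toFun := fun z i j => X z.1 i j + A i j * (γ i * yy z.2 i + γ j * yy z.2 j)
        + (if i = j then (1 - γ i) * yy z.2 i else 0)
      map_add' := by
        intro z w; ext i j
        simp only [Prod.fst_add, Prod.snd_add, map_add, Pi.add_apply]
        split_ifs <;> ring
      map_smul' := by
        intro t z; ext i j
        simp only [Prod.smul_fst, Prod.smul_snd, map_smul, Pi.smul_apply, smul_eq_mul,
          RingHom.id_apply]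
        split_ifs <;> ring }
  have hMdef : ∀ z i j, M z i j = X z.1 i j + A i j * (γ i * yy z.2 i + γ j * yy z.2 j)
        + (if i = j then (1 - γ i) * yy z.2 i else 0) := fun _ _ _ => rfl
  have hMsymm : ∀ z i j, M z i j = M z j i := by
    intro z i j
    have hs : A i j = A j i := hA.1.apply j i
    by_cases hij : i = j
    · rw [hij]
    · rw [hMdef, hMdef, hXsymm, hs, if_neg hij, if_neg (Ne.symm hij)]; ring
  let F : ((Sym2 (Fin k) → ℝ) × ({i : Fin n // i ≠ u} → ℝ)) →ₗ[ℝ]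
      (G.edgeSet ⊕ Fin n → ℝ) :=
    { toFun := fun z => Sum.elim
        (fun e => M z (Quot.out e.1).1 (Quot.out e.1).2) (fun i => M z i i)
      map_add' := by
        intro z w; ext s; cases s <;> simp
      map_smul' := by
        intro t z; ext s; cases s <;> simp }
  have hF : Function.Injective F := by
    rw [← LinearMap.ker_eq_bot, LinearMap.ker_eq_bot']
    rintro ⟨c, y⟩ hz
    have hdiag : ∀ i, M (c, y) i i = 0 := fun i => congrFun hz (Sum.inr i)
    have hedge : ∀ i j, G.Adj i j → M (c, y) i j = 0 := by
      intro i j hij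
      have h1 : M (c, y) (Quot.out s(i, j)).1 (Quot.out s(i, j)).2 = 0 :=
        congrFun hz (Sum.inl ⟨s(i, j), hij⟩)
      have h2 : s((Quot.out s(i, j)).1, (Quot.out s(i, j)).2) = s(i, j) :=
        Quot.out_eq s(i, j)
      rw [Sym2.eq_iff] at h2
      rcases h2 with ⟨ha, hb⟩ | ⟨ha, hb⟩
      · rwa [ha, hb] at h1
      · rw [ha, hb] at h1
        rw [hMsymm]; exact h1
    have hAG : ∀ i j, i ≠ j → ¬ G.Adj i j → A i j = 0 := by
      intro i j hij hn
      by_contra h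
      exact hn ((hA.2 i j hij).1 h)
    -- the pairing
    have hpair : ∑ i, ∑ j, (if i = j ∨ G.Adj i j then X c i j * X c i j else 0) = 0 := by
      have t1 : ∀ i j, (if i = j ∨ G.Adj i j then X c i j * X c i j else 0)
          = - (γ i * yy y i * (A i j * X c j i)) - γ j * yy y j * (A j i * X c i j) := by
        intro i j
        have hs : A i j = A j i := hA.1.apply j i
        by_cases hij : i = j
        · subst hij
          have := hdiag i
          rw [hMdef] at this
          simp only [if_true] at this
          have h3 : X c i i * (1 - γ i) = 0 := by
            by_cases hr : G.Reachable u i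
            · simp [γ, hr]
            · rw [hXsupp c i hr, zero_mul]
          simp only [true_or, if_true]
          linear_combination X c i i * this - yy y i * h3
        · by_cases hadj : G.Adj i j
          · have := hedge i j hadj
            rw [hMdef, if_neg hij] at this
            simp only [hadj, or_true, if_true]
            rw [hXsymm c j i, ← hs]
            linear_combination X c i j * this
          · rw [← hs, hAG i j hij hadj]
            simp [hij, hadj]
      simp only [t1, Finset.sum_sub_distrib, Finset.sum_neg_distrib]
      have t2 : ∑ i, ∑ j, γ i * yy y i * (A i j * X c j i) = 0 := by
        refine Finset.sum_eq_zero fun i _ => ?_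
        rw [← Finset.mul_sum, hAX, mul_zero]
      have t3 : ∑ i, ∑ j, γ j * yy y j * (A j i * X c i j) = 0 := by
        rw [Finset.sum_comm]; exact t2
      rw [t2, t3]; ring
    have hnn : ∀ i j, 0 ≤ (if i = j ∨ G.Adj i j then X c i j * X c i j else 0) := by
      intro i j; split_ifs
      · exact mul_self_nonneg _
      · exact le_rfl
    have hXpat : ∀ i j, (i = j ∨ G.Adj i j) → X c i j = 0 := by
      intro i j hij
      have h1 := (Finset.sum_eq_zero_iff_of_nonneg
        (fun i _ => Finset.sum_nonneg fun j _ => hnn i j)).1 hpair i (Finset.mem_univ _)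
      have h2 := (Finset.sum_eq_zero_iff_of_nonneg (fun j _ => hnn i j)).1 h1 j
        (Finset.mem_univ _)
      rw [if_pos hij] at h2
      exact mul_self_eq_zero.1 h2
    have hX0 : (Matrix.of (X c)) = 0 := by
      refine hS _ ?_ ?_ ?_ ?_
      · ext i j
        exact hXsymm c j i
      · ext i j
        exact hAX c i j
      · intro i j
        by_cases hij : i = j ∨ G.Adj i j
        · rw [Matrix.of_apply, hXpat i j hij, mul_zero]
        · push Not at hij
          rw [hAG i j hij.1 hij.2, zero_mul]
      · intro i
        exact hXpat i i (Or.inl rfl)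
    have hX0' : ∀ i j, X c i j = 0 := fun i j => congrFun (congrFun hX0 i) j
    have hc0 : c = 0 := hXinj c hX0'
    have hreach : ∀ i, G.Reachable u i → yy y i = 0 := by
      intro i hi
      obtain ⟨w⟩ := hi.symm
      have : ∀ {a d : Fin n}, G.Walk a d → d = u → yy y a = 0 := by
        intro a d w
        induction w with
        | nil => intro h; subst h; simp [yy]
        | cons hadj p ih =>
          rename_i a' b' d'
          intro hd
          have hb := ih hd
          have hrb : G.Reachable u b' := by rw [← hd]; exact p.reachable.symm
          have hra : G.Reachable u a' := hrb.trans hadj.symm.reachable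
          have hm := hedge _ _ hadj
          rw [hMdef, hX0', if_neg hadj.ne, hb] at hm
          have ha : A a' b' ≠ 0 := (hA.2 _ _ hadj.ne).2 hadj
          simpa [γ, hra, ha] using hm
      exact this w rfl
    have hy0 : ∀ i, yy y i = 0 := by
      intro i
      by_cases hr : G.Reachable u i
      · exact hreach i hr
      · have := hdiag i
        rw [hMdef, hX0'] at this
        simpa [γ, hr] using this
    have hy : y = 0 := by
      ext ⟨i, hi⟩
      have := hy0 i
      simpa [yy, hi] using this
    rw [hc0, hy]; rfl
  have hdim := LinearMap.finrank_le_finrank_of_injective hF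
  rw [Module.finrank_prod, Module.finrank_fintype_fun_eq_card,
    Module.finrank_fintype_fun_eq_card, Module.finrank_fintype_fun_eq_card, Sym2.card,
    Fintype.card_sum, Fintype.card_subtype_compl, Fintype.card_fin, Fintype.card_fin,
    Fintype.card_subtype_eq, Nat.choose_two_right, ← Nat.card_eq_fintype_card] at hdim
  have hnpos : 0 < n := u.pos
  have h2 : 2 * ((k + 1) * (k + 1 - 1) / 2) = (k + 1) * k := by
    rw [Nat.add_sub_cancel]
    exact Nat.mul_div_cancel' (by rw [mul_comm]; exact (Nat.even_mul_succ_self k).two_dvd)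
  have : k * (k + 1) = (k + 1) * k := mul_comm _ _
  omega

lemma nullity_le {n : ℕ} (A : Matrix (Fin n) (Fin n) ℝ) : nullity A ≤ n := by
  have := Submodule.finrank_le (LinearMap.ker (Matrix.toLin' A))
  simpa [nullity] using this

lemma sSup_bound {n : ℕ} {G : SimpleGraph (Fin n)} {S : Set ℕ}
    (hS : ∀ m ∈ S, ∃ A : Matrix (Fin n) (Fin n) ℝ,
      DescribesGraph A G ∧ StrongArnold A ∧ nullity A = m) :
    sSup S * (sSup S + 1) ≤ 2 * (Nat.card G.edgeSet + 1) := by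
  rcases S.eq_empty_or_nonempty with rfl | hne
  · simp
  · have hb : BddAbove S := ⟨n, fun m hm => by
      obtain ⟨A, _, _, h⟩ := hS m hm
      rw [← h]; exact nullity_le A⟩
    obtain ⟨A, h1, h2, h3⟩ := hS _ (Nat.sSup_mem hne hb)
    rw [← h3]
    exact sap_bound h1 h2

lemma minor_bound {n : ℕ} {G : SimpleGraph (Fin n)} {m : ℕ} (h : HasCliqueMinor G (m + 1)) :
    m * (m + 1) ≤ 2 * Nat.card G.edgeSet := by
  obtain ⟨B, -, -, hd, he⟩ := h
  choose f hf g hg hadj using he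
  let φ : {x : Fin (m + 1) × Fin (m + 1) // x.1 ≠ x.2} → G.Dart := fun x =>
    ⟨(f x.1.1 x.1.2 x.2, g x.1.1 x.1.2 x.2), hadj _ _ x.2⟩
  have huniq : ∀ p q a, a ∈ B p → a ∈ B q → p = q := by
    intro p q a hp hq
    by_contra hne
    exact Finset.disjoint_left.1 (hd p q hne) hp hq
  have hφ : Function.Injective φ := by
    rintro ⟨⟨p, q⟩, h1⟩ ⟨⟨p', q'⟩, h2⟩ h
    have h3 : f p q h1 = f p' q' h2 := congrArg (fun d : G.Dart => d.fst) h
    have h4 : g p q h1 = g p' q' h2 := congrArg (fun d : G.Dart => d.snd) h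
    have e1 : p = p' := huniq _ _ _ (hf p q h1) (h3 ▸ hf p' q' h2)
    have e2 : q = q' := huniq _ _ _ (hg p q h1) (h4 ▸ hg p' q' h2)
    subst e1 e2; rfl
  have hcard := Fintype.card_le_of_injective φ hφ
  rw [G.dart_card_eq_twice_card_edges] at hcard
  have h5 : Fintype.card {x : Fin (m + 1) × Fin (m + 1) // x.1 ≠ x.2} = m * (m + 1) := by
    have := Finset.offDiag_card (Finset.univ : Finset (Fin (m + 1)))
    rw [Fintype.card_subtype]
    have h6 : (Finset.univ.filter fun x : Fin (m + 1) × Fin (m + 1) => x.1 ≠ x.2)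
      = (Finset.univ : Finset (Fin (m + 1))).offDiag := by ext; simp
    rw [h6, this, Finset.card_univ, Fintype.card_fin]
    have : (m + 1) * (m + 1) = m * (m + 1) + (m + 1) := by ring
    omega
  rw [h5] at hcard
  rwa [Nat.card_eq_fintype_card, ← SimpleGraph.edgeFinset_card]

lemma hadwiger_bound {n : ℕ} (G : SimpleGraph (Fin n)) :
    (hadwiger n G - 1) * (hadwiger n G - 1 + 1) ≤ 2 * (Nat.card G.edgeSet + 1) := by
  have hne : {m | HasCliqueMinor G m}.Nonempty :=
    ⟨0, fun p => p.elim0, fun p => p.elim0, fun p => p.elim0, fun p => p.elim0, fun p => p.elim0⟩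
  have hb : BddAbove {m | HasCliqueMinor G m} := by
    refine ⟨2 * Nat.card G.edgeSet + 1, ?_⟩
    rintro (_ | m) hm
    · exact Nat.zero_le _
    · have := minor_bound hm
      nlinarith
  have hmem : HasCliqueMinor G (hadwiger n G) := Nat.sSup_mem hne hb
  rcases hh : hadwiger n G with _ | m
  · simp
  · rw [hh] at hmem
    have := minor_bound hmem
    simp only [Nat.add_sub_cancel]
    omega

lemma decomp_card {n r : ℕ} {G : Fin r → SimpleGraph (Fin n)} (hG : IsDecomp G) :
    2 * ∑ i, Nat.card (G i).edgeSet ≤ n * (n - 1) := by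
  have h1 : ∑ i, Nat.card (G i).edgeSet = (Finset.univ.biUnion fun i => (G i).edgeFinset).card := by
    rw [Finset.card_biUnion]
    · refine Finset.sum_congr rfl fun i _ => ?_
      rw [Nat.card_eq_fintype_card, ← SimpleGraph.edgeFinset_card]
    · intro i _ j _ hij
      exact SimpleGraph.disjoint_edgeFinset.2 (hG.1 i j hij)
  have h2 : (Finset.univ.biUnion fun i => (G i).edgeFinset) ⊆ (⊤ : SimpleGraph (Fin n)).edgeFinset := by
    intro e he
    simp only [Finset.mem_biUnion, Finset.mem_univ, true_and] at he
    obtain ⟨i, hi⟩ := he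
    exact SimpleGraph.edgeFinset_mono le_top hi
  have h3 := Finset.card_le_card h2
  rw [SimpleGraph.card_edgeFinset_top_eq_card_choose_two, Fintype.card_fin,
    Nat.choose_two_right] at h3
  rw [h1]
  omega

lemma sum_bound {n r : ℕ} (hn : 4 * r ≤ n ^ 2) {G : Fin r → SimpleGraph (Fin n)}
    (hG : IsDecomp G) (k : Fin r → ℕ)
    (hk : ∀ i, k i * (k i + 1) ≤ 2 * (Nat.card (G i).edgeSet + 1)) :
    ((∑ i, k i : ℕ) : ℝ) ≤ Real.sqrt r * n := by
  have h1 : ∑ i, k i * (k i + 1) ≤ n * (n - 1) + 2 * r := by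
    calc _ ≤ ∑ i, 2 * (Nat.card (G i).edgeSet + 1) := Finset.sum_le_sum fun i _ => hk i
      _ = 2 * ∑ i, Nat.card (G i).edgeSet + 2 * r := by
        rw [← Finset.mul_sum, Finset.sum_add_distrib]; simp; ring
      _ ≤ _ := by have := decomp_card hG; omega
  have h2 : n * (n - 1) + n = n ^ 2 := by
    cases n <;> simp; ring
  have h3 : ∑ i, k i * (k i + 1) = ∑ i, k i ^ 2 + ∑ i, k i := by
    rw [← Finset.sum_add_distrib]
    exact Finset.sum_congr rfl fun i _ => by ring
  have h4 : (∑ i, k i) ^ 2 ≤ r * ∑ i, k i ^ 2 := by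
    have := sq_sum_le_card_mul_sum_sq (s := (Finset.univ : Finset (Fin r))) (f := k)
    simpa using this
  set S := ∑ i, k i
  set Q := ∑ i, k i ^ 2
  have h5 : Q + S + n ≤ n ^ 2 + 2 * r := by omega
  have h6 : S ^ 2 ≤ r * n ^ 2 := by
    by_contra hcon
    push Not at hcon
    have hrpos : 0 < r := by
      rcases Nat.eq_zero_or_pos r with rfl | h
      · simp at h4; simp [h4] at hcon
      · exact h
    have h7 : n ^ 2 < Q := by
      have : r * n ^ 2 < r * Q := lt_of_lt_of_le hcon h4
      exact lt_of_mul_lt_mul_left this (Nat.zero_le _)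
    have h8 : S < 2 * r := by omega
    nlinarith
  have h9 : (S : ℝ) ≤ Real.sqrt (r * n ^ 2) := by
    apply Real.le_sqrt_of_sq_le
    exact_mod_cast h6
  rwa [Real.sqrt_mul (Nat.cast_nonneg r), Real.sqrt_sq (Nat.cast_nonneg n)] at h9

lemma NGsumUp_le {n r : ℕ} (β : SimpleGraph (Fin n) → ℕ) (b : ℝ) (hb : 0 ≤ b)
    (h : ∀ G : Fin r → SimpleGraph (Fin n), IsDecomp G → ((∑ i, β (G i) : ℕ) : ℝ) ≤ b) :
    (NGsumUp β r : ℝ) ≤ b := by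
  have : NGsumUp β r ≤ ⌊b⌋₊ := by
    apply csSup_le'
    rintro s ⟨G, hG, rfl⟩
    exact Nat.le_floor (h G hG)
  exact (Nat.cast_le.2 this).trans (Nat.floor_le hb)

end NG

/-- For `r ≥ 2` and `n² ≥ 4r`: `NGΣ↑_β(r;n) ≤ √r·n` for `β ∈ {ξ,ν,μ}`, and
`NGΣ↑_η(r;n) ≤ √r·n + r`. -/
theorem statement1 (r n : ℕ) (hr : 2 ≤ r) (hn : 4 * r ≤ n ^ 2) :
    (∀ β : (m : ℕ) → SimpleGraph (Fin m) → ℕ,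
        (β = NG.xiParam ∨ β = NG.nuParam ∨ β = NG.muParam) →
        (NG.NGsumUp (β n) r : ℝ) ≤ Real.sqrt r * n) ∧
    (NG.NGsumUp (NG.hadwiger n) r : ℝ) ≤ Real.sqrt r * n + r := by
  constructor
  · intro β hβ
    refine NG.NGsumUp_le _ _ (by positivity) fun G hG => ?_
    refine NG.sum_bound hn hG _ fun i => ?_
    rcases hβ with rfl | rfl | rfl
    · exact NG.sSup_bound fun m hm => hm
    · exact NG.sSup_bound fun m ⟨A, h1, _, h2, h3⟩ => ⟨A, h1, h2, h3⟩
    · exact NG.sSup_bound fun m ⟨A, _, h1, h2, _, _, h3⟩ => ⟨A, h1, h2, h3⟩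
  · refine NG.NGsumUp_le _ _ (by positivity) fun G hG => ?_
    have h1 := NG.sum_bound hn hG (fun i => NG.hadwiger n (G i) - 1)
      fun i => NG.hadwiger_bound (G i)
    have h2 : ∑ i, NG.hadwiger n (G i) ≤ ∑ i, (NG.hadwiger n (G i) - 1) + r := by
      calc _ ≤ ∑ i, ((NG.hadwiger n (G i) - 1) + 1) :=
            Finset.sum_le_sum fun i _ => by omega
        _ = _ := by rw [Finset.sum_add_distrib]; simp
    have h3 : ((∑ i, NG.hadwiger n (G i) : ℕ) : ℝ)
        ≤ ((∑ i, (NG.hadwiger n (G i) - 1) : ℕ) : ℝ) + r := by exact_mod_cast h2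
    linarith
end

section
/- Fix an integer r ≥ 2 and let t = t(r) = ⌈√(2r + 1/4) − 1/2⌉. Then for every integer n ≥ t, NGΣ↑_η(r;n) ≥ (r/t)·n − r. In particular, liminf_{n→∞} NGΣ↑_η(r;n)/n ≥ r/t. -/
open scoped Classical

namespace NG

lemma minor_le {n m : ℕ} {G : SimpleGraph (Fin n)} (h : HasCliqueMinor G m) : m ≤ n := by
  obtain ⟨B, h1, -, h3, -⟩ := h
  choose g hg using h1
  have hinj : Function.Injective g := by
    intro p q hpq
    by_contra hne
    exact Finset.disjoint_left.mp (h3 p q hne) (hg p) (hpq ▸ hg q)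
  simpa using Fintype.card_le_of_injective g hinj

lemma minor_bdd {n : ℕ} (G : SimpleGraph (Fin n)) : BddAbove {m | HasCliqueMinor G m} :=
  ⟨n, fun _ h => minor_le h⟩

lemma hadwiger_le {n : ℕ} (G : SimpleGraph (Fin n)) : hadwiger n G ≤ n := by
  unfold hadwiger
  rcases Set.eq_empty_or_nonempty {m | HasCliqueMinor G m} with h | h
  · rw [h]; simp
  · exact csSup_le h fun _ h => minor_le h

lemma sum_le {n r s : ℕ}
    (h : s ∈ {s | ∃ G : Fin r → SimpleGraph (Fin n), IsDecomp G ∧ ∑ i, hadwiger n (G i) = s}) :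
    s ≤ r * n := by
  obtain ⟨G, -, rfl⟩ := h
  calc ∑ i, hadwiger n (G i) ≤ ∑ _i : Fin r, n := Finset.sum_le_sum fun i _ => hadwiger_le _
    _ = r * n := by simp

lemma NGsumUp_le_s3 (n r : ℕ) : NGsumUp (hadwiger n) r ≤ r * n := by
  unfold NGsumUp
  rcases Set.eq_empty_or_nonempty {s | ∃ G : Fin r → SimpleGraph (Fin n),
    IsDecomp G ∧ ∑ i, hadwiger n (G i) = s} with h | h
  · rw [h]; simp
  · exact csSup_le h fun _ h => sum_le h

lemma trt_spec (r : ℕ) : 2 * r ≤ trt r * (trt r + 1) := by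
  have h := Nat.le_ceil (Real.sqrt (2 * (r : ℝ) + 1 / 4) - 1 / 2)
  change _ ≤ ((trt r : ℕ) : ℝ) at h
  have h2 : Real.sqrt (2 * (r : ℝ) + 1 / 4) ≤ trt r + 1 / 2 := by linarith
  rw [Real.sqrt_le_left (by positivity)] at h2
  have : (2 * r : ℝ) ≤ trt r * (trt r + 1) := by nlinarith
  exact_mod_cast this

/-- edges coloured by the blocks of their ends -/
def blockGraph {t r : ℕ} (n : ℕ) (ht : 0 < t) (f : Sym2 (Fin t) → Fin r) (i : Fin r) :
    SimpleGraph (Fin n) where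
  Adj u v := u ≠ v ∧
    f s(⟨u.1 % t, Nat.mod_lt _ ht⟩, ⟨v.1 % t, Nat.mod_lt _ ht⟩) = i
  symm := ⟨fun u v h => ⟨h.1.symm, by rw [Sym2.eq_swap]; exact h.2⟩⟩
  loopless := ⟨fun u h => h.1 rfl⟩

lemma block_decomp {t r : ℕ} (n : ℕ) (ht : 0 < t) (f : Sym2 (Fin t) → Fin r) :
    IsDecomp (blockGraph n ht f) := by
  constructor
  · intro i j hij
    rw [SimpleGraph.disjoint_left]
    intro u v h1 h2
    exact hij (h1.2.symm.trans h2.2)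
  · ext u v
    simp only [SimpleGraph.iSup_adj, SimpleGraph.top_adj]
    constructor
    · rintro ⟨i, h⟩; exact h.1
    · intro h; exact ⟨_, h, rfl⟩

lemma block_minor {t r : ℕ} (n : ℕ) (ht : 0 < t) (f : Sym2 (Fin t) → Fin r)
    (hf : Function.Surjective f) (i : Fin r) : HasCliqueMinor (blockGraph n ht f i) (n / t) := by
  obtain ⟨e, rfl⟩ := hf i
  induction e using Sym2.ind with
  | _ a b =>
  have hlt : ∀ (a : Fin t) (p : Fin (n / t)), a.1 + t * p.1 < n := by
    intro a p
    have h1 : t * (p.1 + 1) ≤ t * (n / t) := Nat.mul_le_mul_left _ p.2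
    have h2 := Nat.mul_div_le n t
    have := a.2
    rw [mul_add] at h1
    omega
  let x : Fin t → Fin (n / t) → Fin n := fun a p => ⟨a.1 + t * p.1, hlt a p⟩
  have hmod : ∀ a p, (⟨(x a p).1 % t, Nat.mod_lt _ ht⟩ : Fin t) = a := by
    intro a p
    ext
    simp [x, Nat.mod_eq_of_lt a.2]
  have hdiv : ∀ a p, (x a p).1 / t = p.1 := by
    intro a p
    simp [x, Nat.add_mul_div_left _ _ ht, Nat.div_eq_of_lt a.2]
  have hne : ∀ a b p q, p ≠ q → x a p ≠ x b q := by
    intro a b p q hpq h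
    apply hpq
    ext
    rw [← hdiv a p, ← hdiv b q, h]
  have hadj : ∀ p q, x a p ≠ x b q → (blockGraph n ht f (f s(a, b))).Adj (x a p) (x b q) := by
    intro p q h
    refine ⟨h, ?_⟩
    rw [hmod, hmod]
  refine ⟨fun p => {x a p, x b p}, fun p => ⟨x a p, by simp⟩, ?_, ?_, ?_⟩
  · intro p
    by_cases h : x a p = x b p
    · beta_reduce
      rw [h, Finset.pair_eq_singleton, Finset.coe_singleton]
      have : Nonempty ({x b p} : Set (Fin n)) := ⟨⟨x b p, rfl⟩⟩
      exact SimpleGraph.Connected.mk fun u v => by rw [Subsingleton.elim u v]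
    · rw [Finset.coe_pair]
      exact SimpleGraph.induce_pair_connected_of_adj (hadj p p h)
  · intro p q hpq
    rw [Finset.disjoint_left]
    intro y h1 h2
    simp only [Finset.mem_insert, Finset.mem_singleton] at h1 h2
    rcases h1 with rfl | rfl <;> rcases h2 with h2 | h2 <;> exact hne _ _ _ _ hpq h2
  · intro p q hpq
    exact ⟨x a p, by simp, x b q, by simp, hadj p q (hne _ _ _ _ hpq)⟩

lemma main_nat {t r : ℕ} (n : ℕ) (hr : 0 < r) (ht : 0 < t) (h : 2 * r ≤ t * (t + 1)) :
    r * (n / t) ≤ NGsumUp (hadwiger n) r := by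
  have : Nonempty (Fin r) := ⟨⟨0, hr⟩⟩
  have hc : Fintype.card (Fin r) ≤ Fintype.card (Sym2 (Fin t)) := by
    rw [Sym2.card, Fintype.card_fin, Fintype.card_fin, Nat.choose_two_right]
    rw [Nat.le_div_iff_mul_le (by norm_num)]
    simp only [Nat.add_sub_cancel]
    nlinarith
  obtain ⟨g⟩ := Function.Embedding.nonempty_of_card_le hc
  have hs : Function.Surjective (Function.invFun g) := Function.invFun_surjective g.injective
  have h1 : r * (n / t) ≤ ∑ i, hadwiger n (blockGraph n ht (Function.invFun g) i) := by
    calc r * (n / t) = ∑ _i : Fin r, n / t := by simp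
      _ ≤ _ := Finset.sum_le_sum fun i _ =>
        le_csSup (minor_bdd _) (block_minor n ht _ hs i)
  exact h1.trans (le_csSup ⟨r * n, fun _ h => sum_le h⟩ ⟨_, block_decomp n ht _, rfl⟩)

end NG

/-- For fixed `r ≥ 2` and `t = ⌈√(2r+1/4) − 1/2⌉`: for all `n ≥ t`,
`NGΣ↑_η(r;n) ≥ (r/t)·n − r`; in particular
`liminf_{n→∞} NGΣ↑_η(r;n)/n ≥ r/t`. -/
theorem statement3 (r : ℕ) (hr : 2 ≤ r) (t : ℕ) (ht : t = NG.trt r) :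
    (∀ n : ℕ, t ≤ n → (r : ℝ) / t * n - r ≤ NG.NGsumUp (NG.hadwiger n) r) ∧
    (r : ℝ) / t ≤
      Filter.liminf (fun n : ℕ => (NG.NGsumUp (NG.hadwiger n) r : ℝ) / n)
        Filter.atTop := by
  have hs : 2 * r ≤ t * (t + 1) := ht ▸ NG.trt_spec r
  have ht0 : 0 < t := by
    rcases Nat.eq_zero_or_pos t with h | h
    · subst h; omega
    · exact h
  have htR : (0 : ℝ) < t := by exact_mod_cast ht0
  have key : ∀ n : ℕ, (r : ℝ) / t * n - r ≤ NG.NGsumUp (NG.hadwiger n) r := by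
    intro n
    have h1 : (r : ℝ) * ((n / t : ℕ) : ℝ) ≤ NG.NGsumUp (NG.hadwiger n) r := by
      exact_mod_cast NG.main_nat n (by omega) ht0 hs
    have h2 : (n : ℝ) / t ≤ ((n / t : ℕ) : ℝ) + 1 := by
      rw [div_le_iff₀ htR]
      have : n ≤ (n / t + 1) * t := by
        have := Nat.lt_div_mul_add (a := n) ht0
        rw [add_mul, one_mul]; exact this.le
      exact_mod_cast this
    have h3 : (r : ℝ) * ((n : ℝ) / t) ≤ r * (((n / t : ℕ) : ℝ) + 1) :=
      mul_le_mul_of_nonneg_left h2 (by positivity)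
    have h4 : (r : ℝ) / t * n = r * ((n : ℝ) / t) := by ring
    rw [h4]; linarith
  refine ⟨fun n _ => key n, ?_⟩
  have hlim : Filter.Tendsto (fun n : ℕ => (r : ℝ) / t - r / n) Filter.atTop
      (nhds ((r : ℝ) / t)) := by
    simpa using (tendsto_const_nhds (x := (r : ℝ) / t)).sub
      (tendsto_const_div_atTop_nhds_zero_nat (r : ℝ))
  rw [← hlim.liminf_eq]
  refine Filter.liminf_le_liminf ?_ hlim.isBoundedUnder_ge ?_
  · filter_upwards [Filter.eventually_gt_atTop 0] with n hn
    have hn' : (0 : ℝ) < n := by exact_mod_cast hn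
    rw [le_div_iff₀ hn', sub_mul, div_mul_cancel₀ _ hn'.ne']
    exact key n
  · apply Filter.IsBoundedUnder.isCoboundedUnder_ge
    refine Filter.isBoundedUnder_of ⟨r, fun n => ?_⟩
    rcases Nat.eq_zero_or_pos n with h | h
    · subst h; simp
    · have hn' : (0 : ℝ) < n := by exact_mod_cast h
      rw [div_le_iff₀ hn']
      exact_mod_cast NG.NGsumUp_le_s3 n r
end

section
/- Let β ∈ {μ, ν, ξ}, fix an integer r ≥ 2, and let t = t(r) = ⌈√(2r + 1/4) − 1/2⌉. Then: (i) for every integer s ≥ 1 and n = ts, (r/t)·n − t ≤ NGΣ↑_β(r;n); and (ii) liminf_{n→∞} NGΣ↑_β(r;n)/n ≥ r/t. -/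
open scoped Classical

namespace NGP
open NG Matrix

/-- Certificate: a matrix witnessing a lower bound on the parameters. -/
def Cert (b : Bool) {n : ℕ} (G : SimpleGraph (Fin n)) (k : ℕ) : Prop :=
  ∃ A : Matrix (Fin n) (Fin n) ℝ, DescribesGraph A G ∧ StrongArnold A ∧ k ≤ nullity A ∧
    (if b then ∀ x : Fin n → ℝ, 0 ≤ x ⬝ᵥ (A *ᵥ x) else
      (∀ i j : Fin n, i ≠ j → A i j ≤ 0) ∧ (∃ p, A p p < 0) ∧
      ∃ l : Fin n → ℝ, ∀ x : Fin n → ℝ, l ⬝ᵥ x = 0 → 0 ≤ x ⬝ᵥ (A *ᵥ x))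

lemma nullity_le {n : ℕ} (A : Matrix (Fin n) (Fin n) ℝ) : nullity A ≤ n := by
  unfold nullity
  have := Submodule.finrank_le (LinearMap.ker (Matrix.toLin' A))
  simpa using this

lemma nullity_ge {n : ℕ} (A B C : Matrix (Fin n) (Fin n) ℝ) (d : Fin n → ℝ)
    (h : A = B * diagonal d * C) (s : Finset (Fin n)) (hs : ∀ i ∈ s, d i = 0) :
    s.card ≤ nullity A := by
  have h1 : A.rank ≤ (diagonal d).rank := by
    rw [h]
    exact (Matrix.rank_mul_le_left _ _).trans (Matrix.rank_mul_le_right _ _)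
  rw [Matrix.rank_diagonal] at h1
  have h2 : A.rank + nullity A = n := by
    have := LinearMap.finrank_range_add_finrank_ker (Matrix.toLin' A)
    simp only [Module.finrank_fintype_fun_eq_card, Fintype.card_fin] at this
    exact this
  have h3 : Fintype.card {i // d i ≠ 0} + s.card ≤ n := by
    rw [Fintype.card_subtype]
    rw [← Finset.card_union_of_disjoint]
    · exact (Finset.card_le_univ _).trans (by simp)
    · rw [Finset.disjoint_left]
      intro a ha hb
      simp only [Finset.mem_filter] at ha
      exact ha.2 (hs a hb)
  omega

lemma neg_card {n : ℕ} (A : Matrix (Fin n) (Fin n) ℝ) (hA : A.IsHermitian)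
    (p : Fin n) (hp : A p p < 0) (l : Fin n → ℝ)
    (hl : ∀ x : Fin n → ℝ, l ⬝ᵥ x = 0 → 0 ≤ x ⬝ᵥ (A *ᵥ x)) :
    (Finset.univ.filter (fun i => hA.eigenvalues i < 0)).card = 1 := by
  have hex : ∃ i, hA.eigenvalues i < 0 := by
    by_contra! hc
    have : A.PosSemidef := hA.posSemidef_iff_eigenvalues_nonneg.2 hc
    have := this.diag_nonneg (i := p)
    linarith
  obtain ⟨i, hi⟩ := hex
  rw [Finset.card_eq_one]
  refine ⟨i, ?_⟩
  ext j
  simp only [Finset.mem_filter, Finset.mem_univ, true_and, Finset.mem_singleton]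
  refine ⟨fun hj => ?_, fun h => h ▸ hi⟩
  by_contra hne
  set u : Fin n → ℝ := ⇑(hA.eigenvectorBasis i) with hu
  set v : Fin n → ℝ := ⇑(hA.eigenvectorBasis j) with hv
  have hAu : A *ᵥ u = hA.eigenvalues i • u := hA.mulVec_eigenvectorBasis i
  have hAv : A *ᵥ v = hA.eigenvalues j • v := hA.mulVec_eigenvectorBasis j
  have huu : u ⬝ᵥ u = 1 := by
    have := hA.eigenvectorBasis.inner_eq_one i
    rw [EuclideanSpace.inner_eq_star_dotProduct] at this
    simpa using this
  have hvv : v ⬝ᵥ v = 1 := by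
    have := hA.eigenvectorBasis.inner_eq_one j
    rw [EuclideanSpace.inner_eq_star_dotProduct] at this
    simpa using this
  have huv : u ⬝ᵥ v = 0 := by
    have := hA.eigenvectorBasis.inner_eq_zero hne
    rw [EuclideanSpace.inner_eq_star_dotProduct] at this
    simpa using this
  have hvu : v ⬝ᵥ u = 0 := by rw [dotProduct_comm]; exact huv
  have key : ∀ a b : ℝ, a * (l ⬝ᵥ u) + b * (l ⬝ᵥ v) = 0 →
      0 ≤ a ^ 2 * hA.eigenvalues i + b ^ 2 * hA.eigenvalues j := by
    intro a b hab
    have := hl (a • u + b • v) (by simpa [dotProduct_add, dotProduct_smul] using hab)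
    simp only [mulVec_add, mulVec_smul, hAu, hAv, dotProduct_add, add_dotProduct,
      dotProduct_smul, smul_dotProduct, huu, hvv, huv, hvu, smul_eq_mul] at this
    nlinarith
  by_cases h0 : l ⬝ᵥ u = 0
  · have := key 1 0 (by simp [h0])
    linarith
  · have := key (l ⬝ᵥ v) (-(l ⬝ᵥ u)) (by ring)
    have h1 : 0 < (l ⬝ᵥ u) ^ 2 := by positivity
    have h2 : 0 ≤ (l ⬝ᵥ v) ^ 2 := by positivity
    nlinarith

lemma bdd_xi {n : ℕ} (S : Set ℕ) (h : ∀ m ∈ S, ∃ A : Matrix (Fin n) (Fin n) ℝ, nullity A = m) :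
    BddAbove S := ⟨n, fun m hm => by obtain ⟨A, rfl⟩ := h m hm; exact nullity_le A⟩

lemma sSup_le_n {n : ℕ} (S : Set ℕ) (h : ∀ m ∈ S, ∃ A : Matrix (Fin n) (Fin n) ℝ, nullity A = m) :
    sSup S ≤ n := by
  rcases S.eq_empty_or_nonempty with rfl | hne
  · simp
  · exact csSup_le hne fun m hm => by obtain ⟨A, rfl⟩ := h m hm; exact nullity_le A

lemma beta_facts (β : (n : ℕ) → SimpleGraph (Fin n) → ℕ)
    (hβ : β = NG.muParam ∨ β = NG.nuParam ∨ β = NG.xiParam) :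
    (∀ n G, β n G ≤ n) ∧ ∃ b : Bool, ∀ n (G : SimpleGraph (Fin n)) k, Cert b G k → k ≤ β n G := by
  rcases hβ with rfl | rfl | rfl
  · refine ⟨fun n G => sSup_le_n _ ?_, false, ?_⟩
    · rintro m ⟨A, hA, -, -, -, -, h⟩; exact ⟨A, h⟩
    · rintro n G k ⟨A, h1, h2, h3, h4⟩
      simp only [Bool.false_eq_true, if_false] at h4
      obtain ⟨h4, ⟨p, hp⟩, l, hl⟩ := h4
      have hA : A.IsHermitian := by
        rw [IsHermitian, conjTranspose_eq_transpose_of_trivial]; exact h1.1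
      refine h3.trans (le_csSup (bdd_xi (n := n) _ ?_) ⟨A, hA, h1, h2, neg_card A hA p hp l hl, h4, rfl⟩)
      rintro m ⟨A, hA, -, -, -, -, h⟩; exact ⟨A, h⟩
  · refine ⟨fun n G => sSup_le_n _ ?_, true, ?_⟩
    · rintro m ⟨A, -, -, -, h⟩; exact ⟨A, h⟩
    · rintro n G k ⟨A, h1, h2, h3, h4⟩
      simp only [if_true] at h4
      have hA : A.IsHermitian := by
        rw [IsHermitian, conjTranspose_eq_transpose_of_trivial]; exact h1.1
      refine h3.trans (le_csSup (bdd_xi (n := n) _ ?_) ⟨A, h1, ?_, h2, rfl⟩)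
      · rintro m ⟨A, -, -, -, h⟩; exact ⟨A, h⟩
      · exact .of_dotProduct_mulVec_nonneg hA (by simpa using h4)
  · refine ⟨fun n G => sSup_le_n _ ?_, true, ?_⟩
    · rintro m ⟨A, -, -, h⟩; exact ⟨A, h⟩
    · rintro n G k ⟨A, h1, h2, h3, h4⟩
      refine h3.trans (le_csSup (bdd_xi (n := n) _ ?_) ⟨A, h1, h2, rfl⟩)
      rintro m ⟨A, -, -, h⟩; exact ⟨A, h⟩

lemma arith_pos (N : ℕ) (hN : 1 ≤ N) (c : ℝ) (hc : c * (((N : ℝ) - 1) + N ^ 2) = 2) :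
    0 < c ∧ c - 1 ≠ 0 ∧ c * N ^ 2 - 1 ≠ 0 := by
  have h1 : (1 : ℝ) ≤ N := by exact_mod_cast hN
  refine ⟨?_, ?_, ?_⟩
  · by_contra! h
    nlinarith [mul_nonneg (neg_nonneg.2 h) (by nlinarith : (0 : ℝ) ≤ ((N : ℝ) - 1) + N ^ 2)]
  · intro h
    have : c = 1 := by linarith
    rw [this] at hc
    have h3 : (N : ℝ) + N ^ 2 = 3 := by linarith
    have h4 : N + N ^ 2 = 3 := by exact_mod_cast h3
    have : N < 2 := by nlinarith
    interval_cases N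
    omega
  · intro h
    have h3 : c * N ^ 2 = 1 := by linarith
    have h4 : c * ((N : ℝ) - 1) = 1 := by linarith
    have hc0 : c ≠ 0 := by rintro rfl; simp at h4
    have : (N : ℝ) ^ 2 = N - 1 := mul_left_cancel₀ hc0 (by rw [h3, h4])
    nlinarith

lemma arith_neg (N : ℕ) (hN : 1 ≤ N) (c : ℝ) (hc : c * (((N : ℝ) - 1) - N ^ 2) = 2) :
    c < 0 ∧ c * N < 0 ∧ c * N * N + 1 < 0 := by
  have h1 : (1 : ℝ) ≤ N := by exact_mod_cast hN
  have hcneg : c < 0 := by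
    by_contra! h
    nlinarith [mul_nonneg h (by nlinarith : (0 : ℝ) ≤ N ^ 2 - ((N : ℝ) - 1))]
  refine ⟨hcneg, by nlinarith, ?_⟩
  nlinarith [mul_nonneg (neg_nonneg.2 hcneg.le) (by linarith : (0 : ℝ) ≤ (N : ℝ) - 1)]

lemma exists_Q (b : Bool) {n : ℕ} (P : Finset (Fin n)) (p0 : Fin n) (hp0 : p0 ∈ P) :
    ∃ (D : Fin n → ℝ) (Q : Fin n → Fin n → ℝ),
      (∀ k, D k = if k = p0 then (if b then 1 else -1) else 1) ∧
      (∀ l ∈ P, ∀ m ∈ P, ∑ k ∈ P, D k * Q k l * Q k m = if l = m then D l else 0) ∧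
      (∀ k l, Q k l ≠ 0) ∧ (b = false → ∀ k l, Q k l < 0) := by
  set ε : ℝ := if b then 1 else -1 with hε
  have hε2 : ε * ε = 1 := by rw [hε]; split_ifs <;> norm_num
  set N : ℕ := P.card with hNdef
  have hN : 1 ≤ N := Finset.card_pos.2 ⟨p0, hp0⟩
  have hN1 : (1 : ℝ) ≤ N := by exact_mod_cast hN
  set D : Fin n → ℝ := fun k => if k = p0 then ε else 1 with hD
  set v : Fin n → ℝ := fun k => if k = p0 then N else 1 with hv
  have hDD : ∀ k, D k * D k = 1 := by
    intro k; simp only [hD]; split_ifs <;> simp [hε2]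
  have hD0 : ∀ k, D k ≠ 0 := fun k h => by have := hDD k; simp [h] at this
  set S : ℝ := ∑ k ∈ P, D k * v k ^ 2 with hS
  have hSval : S = (N - 1) + ε * N ^ 2 := by
    rw [hS, ← Finset.add_sum_erase _ _ hp0]
    have : ∑ k ∈ P.erase p0, D k * v k ^ 2 = ∑ k ∈ P.erase p0, (1 : ℝ) := by
      refine Finset.sum_congr rfl fun k hk => ?_
      have := Finset.ne_of_mem_erase hk
      simp [hD, hv, this]
    rw [this, Finset.sum_const, Finset.card_erase_of_mem hp0, ← hNdef]
    simp only [hD, hv, if_true, nsmul_eq_mul, mul_one]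
    rw [Nat.cast_sub hN]; push_cast; ring
  have hS0 : S ≠ 0 := by
    rw [hSval, hε]
    split_ifs
    · nlinarith
    · nlinarith
  set c : ℝ := 2 / S with hcdef
  have hcS : c * S = 2 := by rw [hcdef]; field_simp
  set Q : Fin n → Fin n → ℝ := fun k l => c * v k * v l - (if k = l then D k else 0) with hQ
  have hQQ : ∀ l ∈ P, ∀ m ∈ P, ∑ k ∈ P, D k * Q k l * Q k m = if l = m then D l else 0 := by
    intro l hl m hm
    have e1 : ∀ k ∈ P, D k * Q k l * Q k m = c ^ 2 * v l * v m * (D k * v k ^ 2)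
        - (if k = l then c * v l * v m else 0) - (if k = m then c * v l * v m else 0)
        + (if k = l then (if l = m then D l else 0) else 0) := by
      intro k _
      simp only [hQ]
      have := hDD k
      by_cases h1 : k = l
      · subst h1
        by_cases h2 : k = m
        · subst h2
          simp only [if_true]
          linear_combination (-2 * c * v k * v k + D k) * this
        · simp only [h2, if_true, if_false]
          linear_combination (-c * v k * v m) * this
      · by_cases h2 : k = m
        · subst h2
          simp only [h1, if_true, if_false]
          linear_combination (-c * v k * v l) * this
        · simp only [h1, h2, if_false]; ring
    rw [Finset.sum_congr rfl e1, Finset.sum_add_distrib, Finset.sum_sub_distrib,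
      Finset.sum_sub_distrib, ← Finset.mul_sum, ← hS]
    simp only [Finset.sum_ite_eq', hl, hm, if_true]
    linear_combination (c * v l * v m) * hcS
  have hQneg : b = false → ∀ k l, Q k l < 0 := by
    intro hb k l
    have hc1 : c * (((N : ℝ) - 1) - N ^ 2) = 2 := by
      rw [← hcS, hSval, hε, hb]; simp only [Bool.false_eq_true, if_false]; ring
    obtain ⟨a1, a2, a3⟩ := arith_neg N hN c hc1
    have hε' : ε = -1 := by rw [hε, hb]; simp
    by_cases h1 : k = l
    · subst h1
      by_cases h4 : k = p0
      · simp only [hQ, hv, hD, h4, if_true, hε']; linarith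
      · simp only [hQ, hv, hD, h4, if_true, if_false]; linarith
    · simp only [hQ, hv, h1, if_false]
      split_ifs <;> linarith
  refine ⟨D, Q, fun k => rfl, hQQ, ?_, hQneg⟩
  intro k l
  rcases hb : b with _ | _
  · exact (hQneg hb k l).ne
  · have hε' : ε = 1 := by rw [hε, hb]; simp
    have hc1 : c * (((N : ℝ) - 1) + N ^ 2) = 2 := by
      rw [← hcS, hSval, hε']; ring
    obtain ⟨a1, a2, a3⟩ := arith_pos N hN c hc1
    have hN0 : (N : ℝ) ≠ 0 := by positivity
    have a4 := a1.ne'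
    by_cases h1 : k = l
    · subst h1
      by_cases h4 : k = p0
      · simp only [hQ, hv, hD, h4, if_true, hε']; intro h; apply a3; linarith
      · simp only [hQ, hv, hD, h4, if_true, if_false]; intro h; apply a2; linarith
    · simp only [hQ, hv, h1, if_false, sub_zero]
      split_ifs <;> first | exact mul_ne_zero (mul_ne_zero a4 (by simpa using hN0)) (by simpa using hN0) | exact mul_ne_zero (mul_ne_zero a4 (by simp)) (by simpa using hN0) | exact mul_ne_zero (mul_ne_zero a4 (by simpa using hN0)) (by simp) | exact mul_ne_zero (mul_ne_zero a4 (by simp)) (by simp)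

lemma bip_cert (b : Bool) {n : ℕ} (P R : Finset (Fin n)) (hd : Disjoint P R)
    (hc : R.card ≤ P.card) (hP : P.Nonempty) (G : SimpleGraph (Fin n))
    (hG : ∀ x y, G.Adj x y ↔ (x ∈ P ∧ y ∈ R) ∨ (x ∈ R ∧ y ∈ P)) : Cert b G R.card := by
  obtain ⟨p0, hp0⟩ := hP
  obtain ⟨f, hfP, hfinj⟩ : ∃ f : Fin n → Fin n, (∀ x ∈ R, f x ∈ P) ∧ Set.InjOn f R := by
    obtain ⟨S, hS, hcard⟩ := Finset.exists_subset_card_eq hc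
    let e := Finset.equivOfCardEq hcard.symm
    refine ⟨fun x => if h : x ∈ R then (e ⟨x, h⟩ : Fin n) else x, ?_, ?_⟩
    · intro x hx
      simp only [hx, dif_pos]
      exact hS (e ⟨x, hx⟩).2
    · intro x hx y hy hxy
      simp only [Finset.mem_coe] at hx hy
      simp only [hx, hy, dif_pos] at hxy
      have := e.injective (Subtype.ext hxy)
      simpa using this
  have hdP : ∀ x, x ∈ P → x ∉ R := fun x h1 h2 => Finset.disjoint_left.1 hd h1 h2
  obtain ⟨D, Q, hD, hQQ, hQne, hQneg⟩ := exists_Q b P p0 hp0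
  have hDD : ∀ k, D k * D k = 1 := by
    intro k; rw [hD]; split_ifs <;> norm_num
  have hD0 : ∀ k, D k ≠ 0 := fun k h => by have := hDD k; simp [h] at this
  -- the matrix
  set d : Fin n → ℝ := fun k => if k ∈ R then 0 else D k with hdd
  let M : Matrix (Fin n) (Fin n) ℝ := Matrix.of fun k x =>
    if x ∈ R then (if k ∈ P then D k * Q k (f x) else 0) else (if k = x then 1 else 0)
  have hM : ∀ k x, M k x =
    if x ∈ R then (if k ∈ P then D k * Q k (f x) else 0) else (if k = x then 1 else 0) :=
    fun _ _ => rfl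
  set A : Matrix (Fin n) (Fin n) ℝ := Mᵀ * diagonal d * M with hA
  have hAe : ∀ x y, A x y = ∑ k, d k * M k x * M k y := by
    intro x y
    rw [hA, Matrix.mul_apply]
    refine Finset.sum_congr rfl fun k _ => ?_
    rw [Matrix.mul_diagonal, transpose_apply]; ring
  have hsymm : ∀ x y, A x y = A y x := by
    intro x y; rw [hAe, hAe]; exact Finset.sum_congr rfl fun k _ => by ring
  have hA1 : ∀ x y, x ∉ R → A x y = D x * M x y := by
    intro x y hx
    rw [hAe, Finset.sum_eq_single x]
    · simp [hM, hx, hdd]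
    · intro k _ hk; simp [hM, hx, hk]
    · simp
  have hA2 : ∀ x ∈ R, ∀ y ∈ R, A x y = if x = y then D (f x) else 0 := by
    intro x hx y hy
    rw [hAe]
    have : ∀ k, d k * M k x * M k y = if k ∈ P then D k * Q k (f x) * Q k (f y) else 0 := by
      intro k
      simp only [hM, hx, hy, if_true]
      by_cases hk : k ∈ P
      · simp only [hk, if_true, hdd, hdP k hk, if_false]
        linear_combination (D k * Q k (f x) * Q k (f y)) * hDD k
      · simp [hk]
    simp_rw [this]
    rw [← Finset.sum_filter, Finset.filter_mem_eq_inter, Finset.univ_inter,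
      hQQ _ (hfP x hx) _ (hfP y hy)]
    by_cases hxy : x = y
    · simp [hxy]
    · have : f x ≠ f y := fun h => hxy (hfinj hx hy h)
      simp [hxy, this]
  have hA3 : ∀ x ∈ P, ∀ y ∈ R, A x y = Q x (f y) := by
    intro x hx y hy
    rw [hA1 x y (hdP x hx)]
    simp only [hM, hx, hy, if_true]
    linear_combination (Q x (f y)) * hDD x
  have hdiag : ∀ x, A x x ≠ 0 := by
    intro x
    by_cases hx : x ∈ R
    · rw [hA2 x hx x hx]; simp [hD0]
    · rw [hA1 x x hx]; simp [hM, hx, hD0]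
  have hzero : ∀ x y, x ≠ y → ¬ G.Adj x y → A x y = 0 := by
    intro x y hxy hn
    rw [hG] at hn
    push Not at hn
    by_cases hx : x ∈ R
    · by_cases hy : y ∈ R
      · rw [hA2 x hx y hy]; simp [hxy]
      · rw [hsymm, hA1 y x hy]; simp [hM, hx, hn.2 hx]
    · rw [hA1 x y hx]
      by_cases hy : y ∈ R
      · have : x ∉ P := fun h => hn.1 h hy
        simp [hM, hy, this]
      · simp [hM, hy, hxy]
  have hadj : ∀ x y, G.Adj x y → ∃ k l, A x y = Q k l := by
    intro x y h
    rw [hG] at h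
    rcases h with ⟨h1, h2⟩ | ⟨h1, h2⟩
    · exact ⟨_, _, hA3 x h1 y h2⟩
    · exact ⟨_, _, by rw [hsymm]; exact hA3 y h2 x h1⟩
  have hpat : ∀ x y, x ≠ y → (A x y ≠ 0 ↔ G.Adj x y) := by
    intro x y hxy
    constructor
    · intro h; by_contra hn; exact h (hzero x y hxy hn)
    · intro h
      obtain ⟨k, l, e⟩ := hadj x y h
      rw [e]; exact hQne k l
  have hform : ∀ x : Fin n → ℝ, x ⬝ᵥ (A *ᵥ x) = ∑ k, d k * ((M *ᵥ x) k) ^ 2 := by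
    intro x
    rw [hA, ← mulVec_mulVec, ← mulVec_mulVec, dotProduct_mulVec, vecMul_transpose, dotProduct]
    refine Finset.sum_congr rfl fun k _ => ?_
    rw [mulVec_diagonal]; ring
  refine ⟨A, ⟨?_, hpat⟩, ?_, nullity_ge A _ _ d hA R ?_, ?_⟩
  · ext x y; exact hsymm y x
  · intro X hX hAX hAoX hXd
    have hXs : ∀ x y, X x y = X y x := fun x y => by
      have := congrFun (congrFun hX y) x
      exact this
    have hXadj : ∀ x y, G.Adj x y → X x y = 0 := by
      intro x y h
      have := hAoX x y
      rcases mul_eq_zero.1 this with h1 | h1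
      · exact absurd h1 ((hpat x y h.ne).2 h)
      · exact h1
    have main : ∀ x y, (∀ z, G.Adj x z → G.Adj z y) → X x y = 0 := by
      intro x y h
      have h1 : (A * X) x y = 0 := by rw [hAX]; rfl
      rw [Matrix.mul_apply, Finset.sum_eq_single x] at h1
      · exact (mul_eq_zero.1 h1).resolve_left (hdiag x)
      · intro z _ hz
        by_cases hxz : G.Adj x z
        · rw [hXadj z y (h z hxz), mul_zero]
        · rw [hzero x z (Ne.symm hz) hxz, zero_mul]
      · simp
    ext x y
    change X x y = 0
    by_cases hxy : G.Adj x y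
    · exact hXadj x y hxy
    · by_cases h : ∀ z, G.Adj x z → G.Adj z y
      · exact main x y h
      · rw [hXs]
        apply main
        intro z hz
        exfalso
        apply h
        intro w hw
        rw [hG] at hxy hz hw ⊢
        have a1 := hdP x; have a2 := hdP y; have a3 := hdP z; have a4 := hdP w
        tauto
  · intro i hi; simp [hdd, hi]
  · cases hb : b
    · simp only [Bool.false_eq_true, if_false]
      refine ⟨?_, ⟨p0, ?_⟩, fun x => M p0 x, ?_⟩
      · intro i j hij
        by_cases h : G.Adj i j
        · obtain ⟨k, l, e⟩ := hadj i j h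
          rw [e]; exact (hQneg hb k l).le
        · rw [hzero i j hij h]
      · rw [hA1 p0 p0 (hdP p0 hp0)]
        simp [hM, hdP p0 hp0, hD, hb]
      · intro x hx
        rw [hform]
        refine Finset.sum_nonneg fun k _ => ?_
        by_cases hk : k = p0
        · have : (M *ᵥ x) k = 0 := by rw [hk]; exact hx
          simp [this]
        · have : 0 ≤ d k := by simp only [hdd, hD, hk, if_false]; split_ifs <;> norm_num
          positivity
    · simp only [if_true]
      intro x
      rw [hform]
      refine Finset.sum_nonneg fun k _ => ?_
      have : 0 ≤ d k := by
        simp only [hdd, hD, hb, if_true]; split_ifs <;> norm_num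
      positivity

lemma clique_cert (b : Bool) {n : ℕ} (V : Finset (Fin n)) (hV : V.Nonempty)
    (G : SimpleGraph (Fin n)) (h1 : ∀ x ∈ V, ∀ y ∈ V, x ≠ y → G.Adj x y)
    (h2 : ∀ x ∈ V, ∀ y ∉ V, ¬ G.Adj x y) : Cert b G (V.card - 1) := by
  obtain ⟨p0, hp0⟩ := hV
  set ε : ℝ := if b then 1 else -1 with hε
  have hε0 : ε ≠ 0 := by rw [hε]; split_ifs <;> norm_num
  let H : SimpleGraph (Fin n) :=
    { Adj := fun x y => G.Adj x y ∧ x ∉ V ∧ y ∉ V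
      symm := ⟨fun x y h => ⟨h.1.symm, h.2.2, h.2.1⟩⟩
      loopless := ⟨fun x h => G.loopless.1 x h.1⟩ }
  have hH : ∀ x y, H.Adj x y ↔ G.Adj x y ∧ x ∉ V ∧ y ∉ V := fun _ _ => Iff.rfl
  set L := H.lapMatrix ℝ with hL
  have hLoff : ∀ x y, x ≠ y → L x y = if H.Adj x y then -1 else 0 := by
    intro x y hxy
    simp only [hL, SimpleGraph.lapMatrix, SimpleGraph.degMatrix, Matrix.sub_apply,
      Matrix.diagonal_apply_ne _ hxy, SimpleGraph.adjMatrix_apply]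
    split_ifs <;> simp
  have hLV : ∀ x ∈ V, ∀ y, L x y = 0 := by
    intro x hx y
    by_cases hxy : x = y
    · subst hxy
      have : H.degree x = 0 := by
        rw [SimpleGraph.degree_eq_zero]
        intro y hy
        exact hy.2.1 hx
      simp [hL, SimpleGraph.lapMatrix, SimpleGraph.degMatrix, this]
    · rw [hLoff x y hxy, if_neg]
      rw [hH]; tauto
  have hLs : ∀ x y, L x y = L y x := fun x y => by
    have := congrFun (congrFun (H.isSymm_lapMatrix (R := ℝ)) y) x
    exact this
  have hLpsd : ∀ x : Fin n → ℝ, 0 ≤ x ⬝ᵥ (L *ᵥ x) := by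
    intro x
    have := (H.posSemidef_lapMatrix ℝ).dotProduct_mulVec_nonneg x
    simpa using this
  set w : Fin n → ℝ := fun x => if x ∈ V then 1 else 0 with hw
  set A : Matrix (Fin n) (Fin n) ℝ :=
    ε • vecMulVec w w + diagonal (fun x => 1 - w x) + L with hA
  have hAe : ∀ x y, A x y = ε * (w x * w y) + (if x = y then 1 - w x else 0) + L x y := by
    intro x y
    simp [hA, vecMulVec_apply, diagonal_apply]
  have hform : ∀ x : Fin n → ℝ, x ⬝ᵥ (A *ᵥ x) =
      ε * (w ⬝ᵥ x) ^ 2 + ∑ k, (1 - w k) * x k ^ 2 + x ⬝ᵥ (L *ᵥ x) := by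
    intro x
    rw [hA, add_mulVec, add_mulVec, dotProduct_add, dotProduct_add, smul_mulVec,
      dotProduct_smul, vecMulVec_mulVec]
    congr 2
    · simp only [dotProduct_comm x w, op_smul_eq_smul, dotProduct_smul, smul_eq_mul]; ring
    · rw [dotProduct]
      refine Finset.sum_congr rfl fun k _ => ?_
      rw [mulVec_diagonal]; ring
  have hsum : ∀ x : Fin n → ℝ, 0 ≤ ∑ k, (1 - w k) * x k ^ 2 := by
    intro x
    refine Finset.sum_nonneg fun k _ => ?_
    have : 0 ≤ 1 - w k := by simp only [hw]; split_ifs <;> norm_num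
    positivity
  have hsymm : ∀ x y, A x y = A y x := by
    intro x y; rw [hAe, hAe, hLs]
    by_cases h : x = y
    · subst h; rfl
    · simp only [h, Ne.symm h, if_false]; ring
  have hAV : ∀ x ∈ V, ∀ y, A x y = ε * w y := by
    intro x hx y
    rw [hAe, hLV x hx]
    simp [hw, hx]
  have hAo : ∀ x y, x ∉ V → x ≠ y → A x y = if G.Adj x y then -1 else 0 := by
    intro x y hx hxy
    rw [hAe, hLoff x y hxy]
    simp only [hw, hx, hxy, if_false, hH, not_false_eq_true, true_and, zero_mul, mul_zero, zero_add]
    by_cases hy : y ∈ V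
    · have : ¬ G.Adj x y := fun h => h2 y hy x hx h.symm
      simp [this]
    · simp [hy]
  refine ⟨A, ⟨?_, ?_⟩, ?_, ?_, ?_⟩
  · ext x y; exact hsymm y x
  · intro x y hxy
    by_cases hx : x ∈ V
    · rw [hAV x hx y]
      by_cases hy : y ∈ V
      · simp [hw, hy, hε0, h1 x hx y hy hxy]
      · simp [hw, hy, h2 x hx y hy]
    · rw [hAo x y hx hxy]; simp
  · intro X hX hAX hAoX hXd
    have hXs : ∀ x y, X x y = X y x := fun x y => by
      have := congrFun (congrFun hX y) x
      exact this
    have hoff : ∀ x y, x ∉ V → X x y = 0 := by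
      intro x y hx
      set u : Fin n → ℝ := fun z => X z y with hu
      have hAu : A *ᵥ u = 0 := by
        ext z
        have : (A * X) z y = 0 := by rw [hAX]; rfl
        rw [Matrix.mul_apply] at this
        exact this
      have hwu : w ⬝ᵥ u = 0 := by
        have : (A *ᵥ u) p0 = 0 := by rw [hAu]; rfl
        simp only [mulVec, dotProduct, hAV p0 hp0, mul_assoc] at this
        rw [← Finset.mul_sum] at this
        exact (mul_eq_zero.1 this).resolve_left hε0
      have hf := hform u
      rw [hAu, hwu] at hf
      simp only [dotProduct_zero] at hf
      have h5 := hLpsd u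
      have h6 := hsum u
      have h7 : ∑ k, (1 - w k) * u k ^ 2 = 0 := by nlinarith
      rw [Finset.sum_eq_zero_iff_of_nonneg] at h7
      · have := h7 x (Finset.mem_univ _)
        simpa [hw, hx, hu] using this
      · intro k _
        have : 0 ≤ 1 - w k := by simp only [hw]; split_ifs <;> norm_num
        positivity
    ext x y
    change X x y = 0
    by_cases hx : x ∈ V
    · by_cases hy : y ∈ V
      · have := hAoX x y
        rw [hAV x hx y] at this
        simpa [hw, hy, hε0] using this
      · rw [hXs]; exact hoff y x hy
    · exact hoff x y hx
  · rw [← Finset.card_erase_of_mem hp0]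
    refine nullity_ge A A (Matrix.of fun k x => if x ∈ V then (if k = p0 then 1 else 0)
      else (if k = x then 1 else 0)) (fun k => if k ∈ V.erase p0 then 0 else 1) ?_ _ ?_
    · ext x y
      rw [Matrix.mul_apply]
      simp only [Matrix.mul_diagonal, Matrix.of_apply]
      by_cases hy : y ∈ V
      · simp only [hy, if_true]
        rw [Finset.sum_eq_single p0]
        · simp only [Finset.mem_erase, ne_eq, not_true, false_and, if_false, if_true, mul_one]
          rw [hsymm x y, hsymm x p0, hAV y hy, hAV p0 hp0]
        · intro k _ hk; simp [hk]
        · simp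
      · simp only [hy, if_false]
        rw [Finset.sum_eq_single y]
        · simp [hy]
        · intro k _ hk; simp [hk]
        · simp
    · intro i hi; simp only [hi, if_true]
  · cases hb : b
    · simp only [Bool.false_eq_true, if_false]
      refine ⟨?_, ⟨p0, ?_⟩, w, ?_⟩
      · intro i j hij
        by_cases hi : i ∈ V
        · rw [hAV i hi]; simp only [hε, hb, hw, Bool.false_eq_true, if_false]; split_ifs <;> norm_num
        · rw [hAo i j hi hij]; split_ifs <;> norm_num
      · rw [hAV p0 hp0]; simp [hw, hp0, hε, hb]
      · intro x hx
        rw [hform, hx]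
        have := hsum x
        have := hLpsd x
        simp only [ne_eq, OfNat.ofNat_ne_zero, not_false_eq_true, zero_pow, mul_zero, zero_add]
        linarith
    · simp only [if_true]
      intro x
      rw [hform]
      have := hsum x
      have := hLpsd x
      have h3 : 0 ≤ ε * (w ⬝ᵥ x) ^ 2 := by simp only [hε, hb, if_true, one_mul]; positivity
      linarith

/-- The graph of pairs with a given label. -/
def labGraph {n : ℕ} {ι : Type} (lab : Fin n → Fin n → ι) (hs : ∀ x y, lab x y = lab y x) (i : ι) :
    SimpleGraph (Fin n) where
  Adj x y := x ≠ y ∧ lab x y = i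
  symm := ⟨fun x y h => ⟨h.1.symm, by rw [hs]; exact h.2⟩⟩
  loopless := ⟨fun x h => h.1 rfl⟩

lemma sum_le_up {n r : ℕ} (β : SimpleGraph (Fin n) → ℕ) {ι : Type} [Fintype ι]
    (hι : Fintype.card ι = r) (lab : Fin n → Fin n → ι) (hs : ∀ x y, lab x y = lab y x) :
    ∑ i, β (labGraph lab hs i) ≤ NGsumUp β r := by
  let e := (Fintype.equivFinOfCardEq hι).symm
  apply le_csSup
  · apply Set.Finite.bddAbove
    apply (Set.finite_range (fun G : Fin r → SimpleGraph (Fin n) => ∑ i, β (G i))).subset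
    rintro s ⟨G, -, h⟩
    exact ⟨G, h⟩
  · refine ⟨fun i => labGraph lab hs (e i), ⟨?_, ?_⟩, ?_⟩
    · intro i j hij
      rw [SimpleGraph.disjoint_left]
      intro x y h1 h2
      exact hij (e.injective (h1.2.symm.trans h2.2))
    · ext x y
      simp only [SimpleGraph.iSup_adj, SimpleGraph.top_adj]
      constructor
      · rintro ⟨i, h⟩; exact h.1
      · intro h; exact ⟨e.symm (lab x y), h, by simp⟩
    · exact e.sum_comp (fun i => β (labGraph lab hs i))

lemma up_le {n r : ℕ} (β : SimpleGraph (Fin n) → ℕ) (hβ : ∀ G, β G ≤ n) :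
    NGsumUp β r ≤ r * n := by
  unfold NGsumUp
  set S := {s | ∃ G : Fin r → SimpleGraph (Fin n), IsDecomp G ∧ ∑ i, β (G i) = s} with hS
  rcases S.eq_empty_or_nonempty with h | hne
  · rw [h]; simp
  · refine csSup_le hne ?_
    rintro s ⟨G, -, rfl⟩
    calc ∑ i, β (G i) ≤ ∑ _i : Fin r, n := Finset.sum_le_sum fun i _ => hβ _
      _ = r * n := by simp

lemma class_card (n t : ℕ) (col : Fin n → Fin t) (hcol : ∀ x, (col x : ℕ) = (x : ℕ) % t)
    (i : Fin t) : n / t ≤ (Finset.univ.filter (fun x => col x = i)).card := by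
  have ht : 0 < t := i.pos
  have hlt : ∀ k : Fin (n / t), (k : ℕ) * t + i < n := by
    intro k
    have h1 : ((k : ℕ) + 1) * t ≤ n := (Nat.mul_le_mul_right t k.2).trans (Nat.div_mul_le_self n t)
    have := i.2
    nlinarith
  have := Finset.card_le_card_of_injOn (s := (Finset.univ : Finset (Fin (n / t))))
    (t := Finset.univ.filter (fun x => col x = i)) (fun k => ⟨(k : ℕ) * t + i, hlt k⟩) ?_ ?_
  · simpa using this
  · intro k _
    simp only [Finset.coe_filter, Finset.mem_univ, true_and, Set.mem_setOf_eq]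
    apply Fin.ext
    rw [hcol]
    simp [Nat.mod_eq_of_lt i.2]
  · intro k _ l _ h
    simp only [Fin.mk.injEq] at h
    apply Fin.ext
    have : (k : ℕ) * t = l * t := by omega
    exact Nat.eq_of_mul_eq_mul_right ht this

lemma main_lb (β : (n : ℕ) → SimpleGraph (Fin n) → ℕ) (b : Bool)
    (hb : ∀ n (G : SimpleGraph (Fin n)) k, Cert b G k → k ≤ β n G)
    (r t n : ℕ) (h1 : t.choose 2 < r) (h2 : r ≤ t.choose 2 + t) :
    r * (n / t) ≤ NGsumUp (β n) r + t := by
  have ht : 0 < t := by omega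
  rcases Nat.eq_zero_or_pos (n / t) with h0 | hq
  · rw [h0]; simp
  set q := n / t with hqdef
  obtain ⟨c, rfl⟩ : ∃ c, r = t.choose 2 + c := ⟨r - t.choose 2, by omega⟩
  have hc0 : 0 < c := by omega
  have hct : c ≤ t := by omega
  let col : Fin n → Fin t := fun x => ⟨(x : ℕ) % t, Nat.mod_lt _ ht⟩
  let V : Fin t → Finset (Fin n) := fun i => Finset.univ.filter (fun x => col x = i)
  have hV : ∀ i x, x ∈ V i ↔ col x = i := by intro i x; simp [V]
  have hVc : ∀ i, q ≤ (V i).card := fun i => class_card n t col (fun _ => rfl) i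
  have hVn : ∀ i, (V i).Nonempty := fun i => Finset.card_pos.1 (hq.trans_le (hVc i))
  let lab : Fin n → Fin n → {z : Sym2 (Fin t) // ¬ z.IsDiag} ⊕ Fin c := fun x y =>
    if h : col x = col y then (if h' : (col x : ℕ) < c then Sum.inr ⟨col x, h'⟩ else
      Sum.inr ⟨0, hc0⟩)
    else Sum.inl ⟨s(col x, col y), by simpa using h⟩
  have hs : ∀ x y, lab x y = lab y x := by
    intro x y
    by_cases h : col x = col y
    · simp [lab, h]
    · have h' : ¬ col y = col x := fun e => h e.symm
      simp [lab, h, h', Sym2.eq_swap]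
  have hι : Fintype.card ({z : Sym2 (Fin t) // ¬ z.IsDiag} ⊕ Fin c) = t.choose 2 + c := by
    rw [Fintype.card_sum, Sym2.card_subtype_not_diag]; simp
  have key := sum_le_up (β n) hι lab hs
  rw [Fintype.sum_sum_type] at key
  have k1 : ∀ z : {z : Sym2 (Fin t) // ¬ z.IsDiag}, q ≤ β n (labGraph lab hs (Sum.inl z)) := by
    have aux : ∀ i j : Fin t, ∀ h : i ≠ j, (V j).card ≤ (V i).card →
        q ≤ β n (labGraph lab hs (Sum.inl ⟨s(i, j), by simpa using h⟩)) := by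
      intro i j hij hcard
      refine (hVc j).trans (hb n _ _ (bip_cert b (V i) (V j) ?_ hcard (hVn i) _ ?_))
      · rw [Finset.disjoint_left]
        intro x hx hy
        rw [hV] at hx hy
        exact hij (hx.symm.trans hy)
      · intro x y
        rw [hV, hV, hV, hV]
        change (x ≠ y ∧ lab x y = _) ↔ _
        by_cases h : col x = col y
        · simp only [lab, h, dif_pos]
          constructor
          · rintro ⟨-, h3⟩; split_ifs at h3
          · rintro (⟨h3, h4⟩ | ⟨h3, h4⟩)
            · exact absurd (h3.symm.trans h4) hij
            · exact absurd (h4.symm.trans h3) hij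
        · have : x ≠ y := fun e => h (by rw [e])
          simp [lab, h, this]
    rintro ⟨z, hz⟩
    induction z using Sym2.ind with
    | _ i j =>
      have hij : i ≠ j := by simpa using hz
      rcases le_total (V j).card (V i).card with h | h
      · exact aux i j hij h
      · have := aux j i hij.symm h
        have e : (⟨s(i, j), hz⟩ : {z : Sym2 (Fin t) // ¬ z.IsDiag}) =
            ⟨s(j, i), by simpa using hij.symm⟩ := Subtype.ext Sym2.eq_swap
        rw [e]; exact this
  have k2 : ∀ k : Fin c, q - 1 ≤ β n (labGraph lab hs (Sum.inr k)) := by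
    intro k
    let i : Fin t := ⟨k, k.2.trans_le hct⟩
    refine (Nat.sub_le_sub_right (hVc i) 1).trans
      (hb n _ _ (clique_cert b (V i) (hVn i) _ ?_ ?_))
    · intro x hx y hy hxy
      rw [hV] at hx hy
      refine ⟨hxy, ?_⟩
      simp [lab, hx, hy, i]
    · intro x hx y hy h
      rw [hV] at hx hy
      have h' := h.2
      have hne : ¬ col x = col y := fun e => hy (e ▸ hx)
      simp [lab, hne] at h'
  have s1 : t.choose 2 * q ≤ ∑ z, β n (labGraph lab hs (Sum.inl z)) := by
    have := Finset.card_nsmul_le_sum Finset.univ (fun z => β n (labGraph lab hs (Sum.inl z))) q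
      (fun z _ => k1 z)
    rw [Finset.card_univ, Sym2.card_subtype_not_diag] at this
    simpa using this
  have s2 : c * (q - 1) ≤ ∑ z, β n (labGraph lab hs (Sum.inr z)) := by
    have := Finset.card_nsmul_le_sum Finset.univ (fun z => β n (labGraph lab hs (Sum.inr z))) (q - 1)
      (fun z _ => k2 z)
    simpa using this
  obtain ⟨p, hp⟩ : ∃ p, q = p + 1 := ⟨q - 1, by omega⟩
  rw [hp] at s1 s2 ⊢
  simp only [Nat.add_sub_cancel] at s2
  nlinarith

lemma trt_facts (r : ℕ) (hr : 2 ≤ r) :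
    (trt r).choose 2 < r ∧ r ≤ (trt r).choose 2 + trt r := by
  set t := trt r with ht
  set z : ℝ := Real.sqrt (2 * (r : ℝ) + 1 / 4) with hz
  have hr' : (2 : ℝ) ≤ r := by exact_mod_cast hr
  have hzz : z * z = 2 * r + 1 / 4 := Real.mul_self_sqrt (by positivity)
  have hz0 : 0 ≤ z := Real.sqrt_nonneg _
  have hz2 : 1 < z := by nlinarith
  have a1 : z - 1 / 2 ≤ t := Nat.le_ceil _
  have a2 : (t : ℝ) < z - 1 / 2 + 1 := Nat.ceil_lt_add_one (by linarith)
  have hc : 2 * t.choose 2 = t * (t - 1) := by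
    rw [Nat.choose_two_right, Nat.mul_div_cancel' (Nat.even_mul_pred_self t).two_dvd]
  have ht1 : 1 ≤ t := by
    by_contra! h
    have : t = 0 := by omega
    rw [this] at a1; simp at a1; linarith
  obtain ⟨u, hu⟩ : ∃ u, t = u + 1 := ⟨t - 1, by omega⟩
  rw [hu] at hc a1 a2 ⊢
  simp only [Nat.add_sub_cancel] at hc
  push_cast at a1 a2
  have b1 : ((u : ℝ) + 1) * u < 2 * r := by nlinarith [(Nat.cast_nonneg u : (0 : ℝ) ≤ u)]
  have b2 : 2 * (r : ℝ) ≤ (u + 1) * (u + 2) := by nlinarith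
  have c1 : (u + 1) * u < 2 * r := by exact_mod_cast b1
  have c2 : 2 * r ≤ (u + 1) * (u + 2) := by exact_mod_cast b2
  constructor
  · omega
  · nlinarith

end NGP

/-- For `β ∈ {μ,ν,ξ}`, fixed `r ≥ 2` and `t = ⌈√(2r+1/4) − 1/2⌉`:
(i) for every `s ≥ 1` and `n = ts`, `(r/t)·n − t ≤ NGΣ↑_β(r;n)`;
(ii) `liminf_{n→∞} NGΣ↑_β(r;n)/n ≥ r/t`. -/
theorem statement4 (r : ℕ) (hr : 2 ≤ r) (t : ℕ) (ht : t = NG.trt r)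
    (β : (n : ℕ) → SimpleGraph (Fin n) → ℕ)
    (hβ : β = NG.muParam ∨ β = NG.nuParam ∨ β = NG.xiParam) :
    (∀ s : ℕ, 1 ≤ s →
        (r : ℝ) / t * ((t * s : ℕ) : ℝ) - t ≤ NG.NGsumUp (β (t * s)) r) ∧
    (r : ℝ) / t ≤
      Filter.liminf (fun n : ℕ => (NG.NGsumUp (β n) r : ℝ) / n)
        Filter.atTop := by
  obtain ⟨hle, b, hb⟩ := NGP.beta_facts β hβ
  obtain ⟨h1, h2⟩ := NGP.trt_facts r hr
  rw [← ht] at h1 h2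
  have ht0 : 0 < t := by omega
  have htR : (0 : ℝ) < t := by exact_mod_cast ht0
  have hlb : ∀ n, r * (n / t) ≤ NG.NGsumUp (β n) r + t := fun n =>
    NGP.main_lb β b hb r t n h1 h2
  constructor
  · intro s _
    have := hlb (t * s)
    rw [Nat.mul_div_cancel_left _ ht0] at this
    have h3 : (r : ℝ) * s ≤ NG.NGsumUp (β (t * s)) r + t := by exact_mod_cast this
    have h4 : (r : ℝ) / t * ((t * s : ℕ) : ℝ) = r * s := by
      push_cast; field_simp
    rw [h4]; linarith
  · have hlim : Filter.Tendsto (fun n : ℕ => (r : ℝ) / t - ((r : ℝ) + t) / n) Filter.atTop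
        (nhds ((r : ℝ) / t)) := by
      have := (tendsto_const_div_atTop_nhds_zero_nat ((r : ℝ) + t)).const_sub ((r : ℝ) / t)
      simpa using this
    rw [← hlim.liminf_eq]
    refine Filter.liminf_le_liminf ?_ hlim.isBoundedUnder_ge ?_
    · filter_upwards [Filter.eventually_gt_atTop 0] with n hn
      have hnR : (0 : ℝ) < n := by exact_mod_cast hn
      have h3 : (r : ℝ) * ((n / t : ℕ) : ℝ) ≤ NG.NGsumUp (β n) r + t := by exact_mod_cast hlb n
      have h4 : (n : ℝ) / t ≤ ((n / t : ℕ) : ℝ) + 1 := by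
        rw [div_le_iff₀ htR]
        have : n ≤ (n / t + 1) * t := by
          rw [add_mul, one_mul]; exact (Nat.lt_div_mul_add ht0).le
        exact_mod_cast this
      have h5 : (r : ℝ) * ((n : ℝ) / t) ≤ r * (((n / t : ℕ) : ℝ) + 1) :=
        mul_le_mul_of_nonneg_left h4 (Nat.cast_nonneg r)
      rw [le_div_iff₀ hnR, sub_mul, div_mul_cancel₀ _ hnR.ne']
      have h6 : (r : ℝ) / t * n = r * ((n : ℝ) / t) := by ring
      rw [h6]; linarith
    · apply Filter.IsBoundedUnder.isCoboundedUnder_ge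
      refine ⟨r, ?_⟩
      rw [Filter.eventually_map]
      filter_upwards [Filter.eventually_gt_atTop 0] with n hn
      have hnR : (0 : ℝ) < n := by exact_mod_cast hn
      rw [div_le_iff₀ hnR]
      exact_mod_cast NGP.up_le (β n) (hle n)
end
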